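/- Let a and b be positive integers, and let s and t be even integers with s, t ≥ 2 such that a·s = b·t. Then OP*(s^⟨a⟩, t^⟨b⟩) has a solution (the list consisting of a copies of s followed by b copies of t). -/

import Mathlib

/-- A solution to the directed Oberwolfach problem OP*(m₁, …, m_k). -/
def HasOPSolution (m : List ℕ) : Prop :=
  ∃ σ : Fin (m.sum - 1) → Equiv.Perm (Fin m.sum),
    (∀ i, (σ i).cycleType = (m : Multiset ℕ)) ∧
    ∀ x y : Fin m.sum, x ≠ y → ∃! i, σ i x = y

section Oberwolfach

open Function

/-- `col` colours the points by the cycles of the permutation `g` of a finite type, and the cycle of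
colour `c` has `len c` points. -/
def IsCycleColoring {V κ : Type} [Fintype V] [DecidableEq κ] (g : V → V) (col : V → κ)
    (len : κ → ℕ) : Prop :=
  Surjective g ∧ (∀ p, col (g p) = col p) ∧ (∀ p q, col p = col q → ∃ n, g^[n] p = q) ∧
    ∀ c, ∑ p, (if col p = c then 1 else 0) = len c

/-- Enlarge a permutation `g` of `V` by new points `N`: a point with image `q` is redirected to
`ent q`, and `nw` describes the images of the new points. -/
def graft {V N : Type} (g : V → V) (ent : V → V ⊕ N) (nw : N → V ⊕ N) : V ⊕ N → V ⊕ N :=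
  Sum.elim (fun p => ent (g p)) nw

lemma reach_trans {V : Type} {g : V → V} {p q r : V} (h₁ : ∃ n, g^[n] p = q)
    (h₂ : ∃ n, g^[n] q = r) : ∃ n, g^[n] p = r := by
  obtain ⟨n, rfl⟩ := h₁
  obtain ⟨m, rfl⟩ := h₂
  exact ⟨m + n, iterate_add_apply g m n p⟩

lemma isCycleColoring_graft {V N κ : Type} [Fintype V] [Fintype N] [DecidableEq κ] {g : V → V}
    {col : V → κ} {len : κ → ℕ} (hg : IsCycleColoring g col len) (c : κ)
    {ent : V → V ⊕ N} {nw : N → V ⊕ N}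
    (hent : ∀ q, ∃ n, (graft g ent nw)^[n] (ent q) = .inl q)
    (hnew : ∀ i, ∃ q, (∃ n, (graft g ent nw)^[n] (ent q) = .inr i) ∧
      ∃ n, (graft g ent nw)^[n] (.inr i) = .inl q)
    (hcol : ∀ q, Sum.elim col (fun _ => c) (ent q) = col q)
    (hcol' : ∀ i, Sum.elim col (fun _ => c) (nw i) = c)
    (hsurj : ∀ w, (∃ q, ent q = w) ∨ ∃ i, nw i = w) :
    IsCycleColoring (graft g ent nw) (Sum.elim col (fun _ => c))
      (update len c (len c + Fintype.card N)) := by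
  obtain ⟨hs, hi, ht, hc⟩ := hg
  have hinv : ∀ p, Sum.elim col (fun _ => c) (graft g ent nw p) =
      Sum.elim col (fun _ => c) p := by
    rintro (p | i)
    · simp [graft, hcol, hi]
    · simp [graft, hcol']
  have hinvn : ∀ n p, Sum.elim col (fun _ => c) ((graft g ent nw)^[n] p) =
      Sum.elim col (fun _ => c) p := by
    intro n
    induction n with
    | zero => simp
    | succ n ih => intro p; rw [iterate_succ_apply, ih, hinv]
  have hstep : ∀ p, ∃ n, (graft g ent nw)^[n] (.inl p) = .inl (g p) := fun p =>
    reach_trans ⟨1, by simp [graft]⟩ (hent (g p))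
  have hold : ∀ n p, ∃ k, (graft g ent nw)^[k] (.inl p) = .inl (g^[n] p) := by
    intro n
    induction n with
    | zero => exact fun p => ⟨0, rfl⟩
    | succ n ih => exact fun p => reach_trans (hstep p) (ih (g p))
  have hto : ∀ w, ∃ p, ∃ n, (graft g ent nw)^[n] w = .inl p := by
    rintro (p | i)
    · exact ⟨p, 0, rfl⟩
    · obtain ⟨q, -, h⟩ := hnew i
      exact ⟨q, h⟩
  have hfrom : ∀ w, ∃ p, ∃ n, (graft g ent nw)^[n] (.inl p) = w := by
    rintro (p | i)
    · exact ⟨p, 0, rfl⟩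
    · obtain ⟨q, h, -⟩ := hnew i
      obtain ⟨p, rfl⟩ := hs q
      exact ⟨p, reach_trans ⟨1, by simp [graft]⟩ h⟩
  refine ⟨?_, hinv, ?_, ?_⟩
  · intro w
    rcases hsurj w with ⟨q, hq⟩ | ⟨i, hq⟩
    · obtain ⟨p, rfl⟩ := hs q
      exact ⟨.inl p, hq⟩
    · exact ⟨.inr i, hq⟩
  · intro w z hwz
    obtain ⟨p, n, hp⟩ := hto w
    obtain ⟨q, m, hq⟩ := hfrom z
    have h₁ := hinvn n w
    have h₂ := hinvn m (.inl q)
    rw [hp] at h₁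
    rw [hq] at h₂
    obtain ⟨k, hk⟩ := ht p q (h₁.trans (hwz.trans h₂))
    refine reach_trans ⟨n, hp⟩ (reach_trans ?_ ⟨m, hq⟩)
    rw [← hk]
    exact hold k p
  · intro d
    rw [Fintype.sum_sum_type]
    simp only [Sum.elim_inl, Sum.elim_inr]
    by_cases h : c = d
    · subst h
      have := hc c
      simp
      exact this
    · have := hc d
      simp [h, update_of_ne (Ne.symm h)]
      exact this

/-- A decomposition of a digraph on `V = L(X) ∪ R(Y)` into three factors. The digraph consists of
the pairs of the matchings `I₀` of `X` and `I₁` of `Y`, the arcs `x → f e x`, and the arcs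
`f e x → p x`. The permutation `p` has cycles of lengths `h c`, each factor has cycles of lengths
`2 * h c`. -/
structure Core {κ : Type} [DecidableEq κ] (h : κ → ℕ) (X Y V : Type) [Fintype X] [Fintype Y]
    [Fintype V] where
  L : X → V
  R : Y → V
  I₀ : X → X
  I₁ : Y → Y
  f : Bool → X → Y
  p : X → X
  σ : Fin 3 → V → V
  colp : X → κ
  col : Fin 3 → V → κ
  bij : Bijective (Sum.elim L R)
  I₀_invol : ∀ x, I₀ (I₀ x) = x
  I₀_ne : ∀ x, I₀ x ≠ x
  I₁_invol : ∀ y, I₁ (I₁ y) = y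
  I₁_ne : ∀ y, I₁ y ≠ y
  f_bij : ∀ e, Bijective (f e)
  f_ne : ∀ x, f false x ≠ f true x
  arc_I₀ : ∀ x, ∃ k, σ k (L x) = L (I₀ x)
  arc_I₁ : ∀ y, ∃ k, σ k (R y) = R (I₁ y)
  arc_f : ∀ e x, ∃ k, σ k (L x) = R (f e x)
  arc_p : ∀ e x, ∃ k, σ k (R (f e x)) = L (p x)
  cyc_p : IsCycleColoring p colp h
  cyc : ∀ k, IsCycleColoring (σ k) (col k) (fun c => 2 * h c)

/-- A place of a `Core` where the cycles of colour `c` can be lengthened. -/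
structure Site {κ : Type} [DecidableEq κ] {h : κ → ℕ} {X Y V : Type} [Fintype X] [Fintype Y]
    [Fintype V] (D : Core h X Y V) (c : κ) where
  x : X
  v : X
  e : Bool
  A : Fin 3
  B : Fin 3
  C : Fin 3
  hAB : A ≠ B
  hAC : A ≠ C
  hBC : B ≠ C
  hA : D.σ A (D.L x) = D.R (D.f e x)
  hB : D.σ B (D.R (D.f e x)) = D.L (D.p x)
  hv : D.σ A (D.L (D.I₀ v)) = D.L v
  hne : v ≠ D.p x
  colA : D.col A (D.L x) = c
  colB : D.col B (D.L (D.p x)) = c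
  colB' : D.col B (D.L v) = c
  colC : D.col C (D.L v) = c
  colv : D.colp v = c

section Grow

variable {κ : Type} [DecidableEq κ] {h : κ → ℕ} {X Y V : Type} [Fintype X] [Fintype Y] [Fintype V]

namespace Core

variable (D : Core h X Y V)

lemma L_inj : Injective D.L := fun a b hab =>
  Sum.inl_injective (D.bij.1 (a₁ := .inl a) (a₂ := .inl b) hab)

lemma R_inj : Injective D.R := fun a b hab =>
  Sum.inr_injective (D.bij.1 (a₁ := .inr a) (a₂ := .inr b) hab)

lemma L_ne_R (a : X) (b : Y) : D.L a ≠ D.R b := fun hab => by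
  simpa using D.bij.1 (a₁ := .inl a) (a₂ := .inr b) hab

lemma cases_LR (v : V) : (∃ x, D.L x = v) ∨ ∃ y, D.R y = v := by
  obtain ⟨x | y, h⟩ := D.bij.2 v
  exacts [.inl ⟨x, h⟩, .inr ⟨y, h⟩]

end Core

open Classical in
/-- The factors after inserting the new vertices `l₁, l₂ = inl false, inl true` and
`r₁, r₂ = inr false, inr true` at a site. -/
noncomputable def growFactor {D : Core h X Y V} {c : κ} (S : Site D c) (k : Fin 3) :
    V ⊕ (Bool ⊕ Bool) → V ⊕ (Bool ⊕ Bool) :=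
  if k = S.A then
    graft (D.σ k) (update .inl (D.R (D.f S.e S.x)) (.inr (.inr false)))
      (Sum.elim (fun i => bif i then .inl (D.R (D.f S.e S.x)) else .inr (.inl true))
        (fun i => bif i then .inr (.inl false) else .inr (.inr true)))
  else if k = S.B then
    graft (D.σ k) (update (update .inl (D.L S.v) (.inr (.inl true)))
        (D.L (D.p S.x)) (.inr (.inl false)))
      (Sum.elim (fun i => .inr (.inr i))
        (fun i => .inl (D.L (bif i then S.v else D.p S.x))))
  else
    graft (D.σ k) (update .inl (D.L S.v) (.inr (.inl true)))
      (Sum.elim (fun i => bif i then .inr (.inl false) else .inr (.inr true))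
        (fun i => bif i then .inr (.inr false) else .inl (D.L S.v)))

lemma Site.eq_C {D : Core h X Y V} {c : κ} (S : Site D c) {k : Fin 3} (hA : k ≠ S.A)
    (hB : k ≠ S.B) : k = S.C := by
  have := S.hAB; have := S.hAC; have := S.hBC
  omega

open Classical in
lemma growFactor_cyc {D : Core h X Y V} {c : κ} (S : Site D c) (k : Fin 3) :
    IsCycleColoring (growFactor S k) (Sum.elim (D.col k) (fun _ => c))
      (fun d => 2 * update h c (h c + 2) d) := by
  have hlen : (fun d => 2 * update h c (h c + 2) d) =
      update (fun d => 2 * h d) c (2 * h c + Fintype.card (Bool ⊕ Bool)) := by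
    ext d
    by_cases hd : d = c
    · subst hd; simp; ring
    · simp [hd]
  rw [hlen]
  unfold growFactor
  split_ifs with hA hB
  · subst hA
    have hcy : D.col S.A (D.R (D.f S.e S.x)) = c := by rw [← S.hA, (D.cyc S.A).2.1, S.colA]
    apply isCycleColoring_graft (D.cyc S.A)
    · intro q
      by_cases hq : q = D.R (D.f S.e S.x)
      · subst hq; exact ⟨4, by simp [graft]⟩
      · exact ⟨0, by simp [hq]⟩
    · rintro ((_ | _) | (_ | _)) <;> refine ⟨D.R (D.f S.e S.x), ?_, ?_⟩
      exacts [⟨2, by simp [graft]⟩, ⟨2, by simp [graft]⟩, ⟨3, by simp [graft]⟩,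
        ⟨1, by simp [graft]⟩, ⟨0, by simp [graft]⟩, ⟨4, by simp [graft]⟩,
        ⟨1, by simp [graft]⟩, ⟨3, by simp [graft]⟩]
    · intro q
      by_cases hq : q = D.R (D.f S.e S.x)
      · subst hq; simp [hcy]
      · simp [hq]
    · rintro ((_ | _) | (_ | _)) <;> simp [hcy]
    · rintro (q | ((_ | _) | (_ | _)))
      · by_cases hq : q = D.R (D.f S.e S.x)
        · exact .inr ⟨.inl true, by simp [hq]⟩
        · exact .inl ⟨q, by simp [hq]⟩
      exacts [.inr ⟨.inr true, rfl⟩, .inr ⟨.inl false, rfl⟩, .inl ⟨D.R (D.f S.e S.x), by simp⟩,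
        .inr ⟨.inr false, rfl⟩]
  · subst hB
    have hne : D.L S.v ≠ D.L (D.p S.x) := fun h => S.hne (D.L_inj h)
    have h₁ : update (update Sum.inl (D.L S.v) (Sum.inr (Sum.inl true)))
        (D.L (D.p S.x)) (Sum.inr (Sum.inl false)) (D.L S.v) =
        (Sum.inr (Sum.inl true) : V ⊕ (Bool ⊕ Bool)) := by
      rw [update_of_ne hne, update_self]
    apply isCycleColoring_graft (D.cyc S.B)
    · intro q
      by_cases hq : q = D.L (D.p S.x)
      · subst hq; exact ⟨2, by simp [graft]⟩
      · by_cases hq' : q = D.L S.v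
        · subst hq'; rw [h₁]; exact ⟨2, by simp [graft]⟩
        · exact ⟨0, by simp [hq, hq']⟩
    · rintro ((_ | _) | (_ | _))
      · refine ⟨D.L (D.p S.x), ⟨0, by simp⟩, ⟨2, by simp [graft]⟩⟩
      · refine ⟨D.L S.v, ⟨0, by simp [h₁]⟩, ⟨2, by simp [graft]⟩⟩
      · refine ⟨D.L (D.p S.x), ⟨1, by simp [graft]⟩, ⟨1, by simp [graft]⟩⟩
      · refine ⟨D.L S.v, ⟨1, by simp [graft, h₁]⟩, ⟨1, by simp [graft]⟩⟩
    · intro q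
      by_cases hq : q = D.L (D.p S.x)
      · subst hq; simp [S.colB]
      · by_cases hq' : q = D.L S.v
        · subst hq'; rw [h₁]; simp [S.colB']
        · simp [hq, hq']
    · rintro ((_ | _) | (_ | _)) <;> simp [S.colB, S.colB']
    · rintro (q | ((_ | _) | (_ | _)))
      · by_cases hq : q = D.L (D.p S.x)
        · exact .inr ⟨.inr false, by simp [hq]⟩
        · by_cases hq' : q = D.L S.v
          · exact .inr ⟨.inr true, by simp [hq']⟩
          · exact .inl ⟨q, by simp [hq, hq']⟩
      exacts [.inl ⟨D.L (D.p S.x), by simp⟩, .inl ⟨D.L S.v, h₁⟩, .inr ⟨.inl false, rfl⟩,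
        .inr ⟨.inl true, rfl⟩]
  · obtain rfl := S.eq_C hA hB
    apply isCycleColoring_graft (D.cyc S.C)
    · intro q
      by_cases hq : q = D.L S.v
      · subst hq; exact ⟨4, by simp [graft]⟩
      · exact ⟨0, by simp [hq]⟩
    · rintro ((_ | _) | (_ | _)) <;> refine ⟨D.L S.v, ?_, ?_⟩
      exacts [⟨1, by simp [graft]⟩, ⟨3, by simp [graft]⟩, ⟨0, by simp [graft]⟩,
        ⟨4, by simp [graft]⟩, ⟨3, by simp [graft]⟩, ⟨1, by simp [graft]⟩,
        ⟨2, by simp [graft]⟩, ⟨2, by simp [graft]⟩]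
    · intro q
      by_cases hq : q = D.L S.v
      · subst hq; simp [S.colC]
      · simp [hq]
    · rintro ((_ | _) | (_ | _)) <;> simp [S.colC]
    · rintro (q | ((_ | _) | (_ | _)))
      · by_cases hq : q = D.L S.v
        · exact .inr ⟨.inr false, by simp [hq]⟩
        · exact .inl ⟨q, by simp [hq]⟩
      exacts [.inr ⟨.inl true, rfl⟩, .inl ⟨D.L S.v, by simp⟩, .inr ⟨.inr true, rfl⟩,
        .inr ⟨.inl false, rfl⟩]

namespace Site

variable {D : Core h X Y V} {c : κ} (S : Site D c)

lemma σ_inj (D : Core h X Y V) (k : Fin 3) : Injective (D.σ k) :=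
  Finite.injective_iff_surjective.2 (D.cyc k).1

lemma p_inj (D : Core h X Y V) : Injective D.p :=
  Finite.injective_iff_surjective.2 D.cyc_p.1

lemma f_ne' (D : Core h X Y V) {e e' : Bool} (he : e ≠ e') (x : X) : D.f e x ≠ D.f e' x := by
  rcases e with _ | _ <;> rcases e' with _ | _ <;> first | exact absurd rfl he | skip
  exacts [D.f_ne x, (D.f_ne x).symm]

open Classical in
lemma growFactor_A : growFactor S S.A =
    graft (D.σ S.A) (update .inl (D.R (D.f S.e S.x)) (.inr (.inr false)))
      (Sum.elim (fun i => bif i then .inl (D.R (D.f S.e S.x)) else .inr (.inl true))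
        (fun i => bif i then .inr (.inl false) else .inr (.inr true))) := by
  simp [growFactor]

open Classical in
lemma growFactor_B : growFactor S S.B =
    graft (D.σ S.B) (update (update .inl (D.L S.v) (.inr (.inl true)))
        (D.L (D.p S.x)) (.inr (.inl false)))
      (Sum.elim (fun i => .inr (.inr i))
        (fun i => .inl (D.L (bif i then S.v else D.p S.x)))) := by
  simp [growFactor, S.hAB.symm]

open Classical in
lemma growFactor_C : growFactor S S.C =
    graft (D.σ S.C) (update .inl (D.L S.v) (.inr (.inl true)))
      (Sum.elim (fun i => bif i then .inr (.inl false) else .inr (.inr true))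
        (fun i => bif i then .inr (.inr false) else .inl (D.L S.v))) := by
  simp [growFactor, S.hAC.symm, S.hBC.symm]

/-- Arcs into `L`-vertices that are not redirected. -/
lemma growFactor_L {k : Fin 3} {q : V} {a : X} (hq : D.σ k q = D.L a)
    (hv : k ≠ S.A → a ≠ S.v) (hw : k = S.B → a ≠ D.p S.x) :
    growFactor S k (.inl q) = .inl (D.L a) := by
  by_cases hA : k = S.A
  · subst hA
    simp [growFactor_A, graft, hq, D.L_ne_R]
  · have h₁ : D.L a ≠ D.L S.v := fun h => hv hA (D.L_inj h)
    by_cases hB : k = S.B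
    · subst hB
      have h₂ : D.L a ≠ D.L (D.p S.x) := fun h => hw rfl (D.L_inj h)
      simp [growFactor_B, graft, hq, h₁, h₂]
    · obtain rfl := S.eq_C hA hB
      simp [growFactor_C, graft, hq, h₁]

/-- Arcs into `R`-vertices that are not redirected. -/
lemma growFactor_R {k : Fin 3} {q : V} {b : Y} (hq : D.σ k q = D.R b)
    (hx : k = S.A → q ≠ D.L S.x) : growFactor S k (.inl q) = .inl (D.R b) := by
  by_cases hA : k = S.A
  · subst hA
    have h₁ : D.R b ≠ D.R (D.f S.e S.x) := by
      rw [← hq, ← S.hA]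
      exact fun h => hx rfl (σ_inj D _ h)
    simp [growFactor_A, graft, hq, h₁]
  · by_cases hB : k = S.B
    · subst hB
      simp [growFactor_B, graft, hq, (D.L_ne_R _ _).symm]
    · obtain rfl := S.eq_C hA hB
      simp [growFactor_C, graft, hq, (D.L_ne_R _ _).symm]

open Classical in
noncomputable def growF (e : Bool) : X ⊕ Bool → Y ⊕ Bool :=
  if e = S.e then
    Sum.elim (fun a => if a = S.x then .inr false else .inl (D.f e a))
      (fun i => bif i then .inl (D.f e S.x) else .inr true)
  else Sum.map (D.f e) id

open Classical in
noncomputable def growP : X ⊕ Bool → X ⊕ Bool :=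
  graft D.p (update .inl S.v (.inr true)) (fun i => bif i then .inr false else .inl S.v)

lemma growP_of_ne {a : X} (ha : D.p a ≠ S.v) : S.growP (.inl a) = .inl (D.p a) := by
  simp [growP, graft, ha]

lemma growP_of_eq {a : X} (ha : D.p a = S.v) : S.growP (.inl a) = .inr true := by
  simp [growP, graft, ha]

lemma growF_of_ne {e : Bool} {a : X} (ha : e = S.e → a ≠ S.x) :
    S.growF e (.inl a) = .inl (D.f e a) := by
  by_cases he : e = S.e
  · simp [growF, he, ha he]
  · simp [growF, he]

/-- The enlarged decomposition, with the cycles of colour `c` lengthened. -/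
noncomputable def grow : Core (update h c (h c + 2)) (X ⊕ Bool) (Y ⊕ Bool) (V ⊕ (Bool ⊕ Bool)) where
  L := Sum.map D.L .inl
  R := Sum.map D.R .inr
  I₀ := Sum.map D.I₀ not
  I₁ := Sum.map D.I₁ not
  f := S.growF
  p := S.growP
  σ := growFactor S
  colp := Sum.elim D.colp (fun _ => c)
  col k := Sum.elim (D.col k) (fun _ => c)
  bij := by
    constructor
    · rintro ((a | i) | (a | i)) ((b | j) | (b | j)) hab <;>
        simp_all [D.L_inj.eq_iff, D.R_inj.eq_iff, D.L_ne_R, (D.L_ne_R _ _).symm]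
    · rintro (v | (i | i))
      · rcases D.cases_LR v with ⟨x, rfl⟩ | ⟨y, rfl⟩
        exacts [⟨.inl (.inl x), rfl⟩, ⟨.inr (.inl y), rfl⟩]
      exacts [⟨.inl (.inr i), rfl⟩, ⟨.inr (.inr i), rfl⟩]
  I₀_invol := by rintro (x | i) <;> simp [D.I₀_invol]
  I₀_ne := by rintro (x | i) <;> simp [D.I₀_ne]
  I₁_invol := by rintro (x | i) <;> simp [D.I₁_invol]
  I₁_ne := by rintro (x | i) <;> simp [D.I₁_ne]
  f_bij e := by
    by_cases he : e = S.e
    · subst he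
      constructor
      · have := fun a => (D.f_bij S.e).1.ne (a₁ := a) (a₂ := S.x)
        rintro (a | (_ | _)) (b | (_ | _)) hab <;> simp only [growF, if_true, Sum.elim_inl,
          Sum.elim_inr] at hab <;> (try split_ifs at hab) <;>
          simp_all [(D.f_bij S.e).1.eq_iff]
      · rintro (y | (_ | _))
        · obtain ⟨x, rfl⟩ := (D.f_bij S.e).2 y
          by_cases hx : x = S.x
          · exact ⟨.inr true, by simp [growF, hx]⟩
          · exact ⟨.inl x, by simp [growF, hx]⟩
        exacts [⟨.inl S.x, by simp [growF]⟩, ⟨.inr false, by simp [growF]⟩]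
    · simp only [growF, if_neg he]
      exact Sum.map_bijective.2 ⟨D.f_bij e, bijective_id⟩
  f_ne := by
    have hf : ∀ e e', e ≠ e' → e = S.e → ∀ x, S.growF e x ≠ S.growF e' x := by
      rintro e e' hee rfl (x | (_ | _)) <;> simp [growF, hee.symm]
      split_ifs with hx
      · simp
      · simpa using f_ne' D hee x
    intro x
    rcases he : S.e with _ | _
    exacts [hf _ _ (by simp) he.symm x, (hf _ _ (by simp) he.symm x).symm]
  arc_I₀ := by
    rintro (a | (_ | _))
    · by_cases ha : D.I₀ a = S.v
      · refine ⟨S.A, S.growFactor_L (a := D.I₀ a) ?_ (by simp) fun h => absurd h S.hAB⟩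
        rw [ha, ← S.hv, ← ha, D.I₀_invol]
      · obtain ⟨k, hk⟩ := D.arc_I₀ a
        refine ⟨k, S.growFactor_L hk (fun _ => ha) ?_⟩
        rintro rfl h
        rw [h, ← S.hB] at hk
        exact D.L_ne_R _ _ (σ_inj D _ hk)
    · exact ⟨S.A, by simp [growFactor_A, graft]⟩
    · exact ⟨S.C, by simp [growFactor_C, graft]⟩
  arc_I₁ := by
    rintro (b | (_ | _))
    · obtain ⟨k, hk⟩ := D.arc_I₁ b
      exact ⟨k, S.growFactor_R hk fun _ => (D.L_ne_R _ _).symm⟩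
    · exact ⟨S.A, by simp [growFactor_A, graft]⟩
    · exact ⟨S.C, by simp [growFactor_C, graft]⟩
  arc_f := by
    rintro e (a | (_ | _))
    · by_cases ha : e = S.e ∧ a = S.x
      · obtain ⟨rfl, rfl⟩ := ha
        exact ⟨S.A, by simp [growFactor_A, growF, graft, S.hA]⟩
      · obtain ⟨k, hk⟩ := D.arc_f e a
        refine ⟨k, ?_⟩
        rw [growF_of_ne _ fun h h' => ha ⟨h, h'⟩]
        refine S.growFactor_R hk ?_
        rintro rfl h
        rw [h, S.hA] at hk
        have hax := D.L_inj h
        subst hax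
        exact f_ne' D (fun h => ha ⟨h.symm, rfl⟩) _ (D.R_inj hk)
    · by_cases he : e = S.e
      · exact ⟨S.C, by simp [growFactor_C, growF, graft, he]⟩
      · exact ⟨S.B, by simp [growFactor_B, growF, graft, he]⟩
    · by_cases he : e = S.e
      · exact ⟨S.A, by simp [growFactor_A, growF, graft, he]⟩
      · exact ⟨S.B, by simp [growFactor_B, growF, graft, he]⟩
  arc_p := by
    rintro e (a | (_ | _))
    · by_cases hav : D.p a = S.v
      · have hax : a ≠ S.x := by
          rintro rfl
          exact S.hne hav.symm
        rw [S.growP_of_eq hav, growF_of_ne _ fun _ => hax]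
        obtain ⟨k, hk⟩ := D.arc_p e a
        rw [hav] at hk
        have hkA : k ≠ S.A := by
          rintro rfl
          rw [← S.hv] at hk
          exact D.L_ne_R _ _ (σ_inj D _ hk).symm
        have hne : D.L S.v ≠ D.L (D.p S.x) := fun h => S.hne (D.L_inj h)
        refine ⟨k, ?_⟩
        by_cases hkB : k = S.B
        · subst hkB
          simp [growFactor_B, graft, hk, hne]
        · obtain rfl := S.eq_C hkA hkB
          simp [growFactor_C, graft, hk]
      · rw [S.growP_of_ne hav]
        by_cases ha : e = S.e ∧ a = S.x
        · obtain ⟨rfl, rfl⟩ := ha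
          exact ⟨S.B, by simp [growFactor_B, growF, graft]⟩
        · rw [growF_of_ne _ fun h h' => ha ⟨h, h'⟩]
          obtain ⟨k, hk⟩ := D.arc_p e a
          refine ⟨k, S.growFactor_L hk (fun _ => hav) ?_⟩
          rintro rfl h
          rw [h, ← S.hB] at hk
          have hax := p_inj D h
          subst hax
          exact f_ne' D (fun h => ha ⟨h, rfl⟩) _ (D.R_inj (σ_inj D _ hk))
    · by_cases he : e = S.e
      · exact ⟨S.B, by simp [growFactor_B, growF, growP, graft, he]⟩
      · exact ⟨S.C, by simp [growFactor_C, growF, growP, graft, he]⟩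
    · by_cases he : e = S.e
      · exact ⟨S.B, by simp [growFactor_B, growF, growP, graft, he, S.hB]⟩
      · exact ⟨S.A, by simp [growFactor_A, growF, growP, graft, he]⟩
  cyc_p := by
    refine isCycleColoring_graft (N := Bool) D.cyc_p c ?_ ?_ ?_ ?_ ?_
    · intro q
      by_cases hq : q = S.v
      · subst hq; exact ⟨2, by simp [graft]⟩
      · exact ⟨0, by simp [hq]⟩
    · rintro (_ | _) <;> refine ⟨S.v, ?_, ?_⟩
      exacts [⟨1, by simp [graft]⟩, ⟨1, by simp [graft]⟩, ⟨0, by simp [graft]⟩,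
        ⟨2, by simp [graft]⟩]
    · intro q
      by_cases hq : q = S.v
      · subst hq; simp [S.colv]
      · simp [hq]
    · rintro (_ | _) <;> simp [S.colv]
    · rintro (q | (_ | _))
      · by_cases hq : q = S.v
        · exact .inr ⟨false, by simp [hq]⟩
        · exact .inl ⟨q, by simp [hq]⟩
      exacts [.inr ⟨true, rfl⟩, .inl ⟨S.v, by simp⟩]
  cyc k := growFactor_cyc S k

/-- The site used for the enlargement survives. -/
noncomputable def growSelf : Site S.grow c where
  x := .inr true
  v := .inl S.v
  e := S.e
  A := S.A
  B := S.B
  C := S.C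
  hAB := S.hAB
  hAC := S.hAC
  hBC := S.hBC
  hA := by simp [grow, growFactor_A, growF, graft]
  hB := by simp [grow, growFactor_B, growF, growP, graft, S.hB]
  hv := by simp [grow, growFactor_A, graft, S.hv, D.L_ne_R]
  hne := by simp [grow, growP, graft]
  colA := by simp [grow]
  colB := by simp [grow, growP, graft]
  colB' := by simp [grow, S.colB']
  colC := by simp [grow, S.colC]
  colv := by simp [grow, S.colv]

/-- Sites of other colours survive. -/
noncomputable def growOther {d : κ} (T : Site D d) (hd : d ≠ c) (hx : T.x ≠ S.x)
    (hpx : D.p T.x ≠ S.v) : Site S.grow d where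
  x := .inl T.x
  v := .inl T.v
  e := T.e
  A := T.A
  B := T.B
  C := T.C
  hAB := T.hAB
  hAC := T.hAC
  hBC := T.hBC
  hA := by
    change growFactor S T.A (.inl (D.L T.x)) =
      Sum.map D.R (.inr : Bool → Bool ⊕ Bool) (S.growF T.e (.inl T.x))
    rw [S.growF_of_ne fun _ => hx]
    exact S.growFactor_R T.hA fun _ h => hx (D.L_inj h)
  hB := by
    change growFactor S T.B (Sum.map D.R (.inr : Bool → Bool ⊕ Bool) (S.growF T.e (.inl T.x))) =
      Sum.map D.L (.inl : Bool → Bool ⊕ Bool) (S.growP (.inl T.x))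
    rw [S.growF_of_ne fun _ => hx, S.growP_of_ne hpx]
    exact S.growFactor_L T.hB (fun _ => hpx) fun _ h => hx (p_inj D h)
  hv := by
    refine S.growFactor_L T.hv (fun _ h => hd ?_) ?_
    · rw [← T.colv, ← S.colv, h]
    · intro hAB h
      have := T.hv
      rw [h, hAB, ← S.hB] at this
      exact D.L_ne_R _ _ (σ_inj D _ this)
  hne := by
    change _ ≠ S.growP (.inl T.x)
    rw [S.growP_of_ne hpx]
    simpa using T.hne
  colA := T.colA
  colB := by
    change Sum.elim (D.col T.B) (fun _ => c)
      (Sum.map D.L (.inl : Bool → Bool ⊕ Bool) (S.growP (.inl T.x))) = d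
    rw [S.growP_of_ne hpx]
    exact T.colB
  colB' := T.colB'
  colC := T.colC
  colv := T.colv

end Site

end Grow

/-- There is a `Core` with pairwise independent sites for all colours in `s`. -/
def Growable {κ : Type} [DecidableEq κ] (h : κ → ℕ) (s : Set κ) : Prop :=
  ∃ (X Y V : Type) (_ : Fintype X) (_ : Fintype Y) (_ : Fintype V) (D : Core h X Y V)
    (T : ∀ c : s, Site D c),
    ∀ c d : s, c ≠ d → (T c).x ≠ (T d).x ∧ D.p (T c).x ≠ (T d).v

open Classical in
lemma Growable.grow {κ : Type} [DecidableEq κ] {h : κ → ℕ} {s : Set κ} (H : Growable h s) {c : κ}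
    (hc : c ∈ s) : Growable (update h c (h c + 2)) s := by
  obtain ⟨X, Y, V, _, _, _, D, T, hT⟩ := H
  let S := T ⟨c, hc⟩
  have hdc : ∀ d : s, (d : κ) ≠ c → d ≠ ⟨c, hc⟩ := fun d hd h => hd (by rw [h])
  refine ⟨_, _, _, inferInstance, inferInstance, inferInstance, S.grow, fun d =>
    if hd : (d : κ) = c then hd ▸ S.growSelf else
      S.growOther (T d) hd (hT _ _ (hdc d hd)).1 (hT _ _ (hdc d hd)).2, ?_⟩
  rintro ⟨d, hd⟩ ⟨d', hd'⟩ hne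
  by_cases h₁ : d = c
  · subst h₁
    have h₂ : d' ≠ d := fun h => hne (by simp [h])
    simp only [dif_pos, dif_neg h₂]
    exact ⟨by simp [Site.growSelf, Site.growOther],
      by simp [Site.growSelf, Site.growOther, Site.grow, Site.growP, graft]⟩
  · by_cases h₂ : d' = d
    · exact absurd (by simp [h₂]) hne
    have h₃ := hT _ _ (hdc ⟨d, hd⟩ h₁)
    by_cases h₄ : d' = c
    · subst h₄
      simp only [dif_pos, dif_neg h₁]
      refine ⟨by simp [Site.growSelf, Site.growOther], ?_⟩
      change S.growP (.inl (T ⟨d, hd⟩).x) ≠ .inl S.v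
      rw [S.growP_of_ne h₃.2]
      simpa using h₃.2
    · simp only [dif_neg h₁, dif_neg h₄]
      refine ⟨by simpa [Site.growOther] using (hT _ _ hne).1, ?_⟩
      change S.growP (.inl (T ⟨d, hd⟩).x) ≠ .inl (T ⟨d', hd'⟩).v
      rw [S.growP_of_ne h₃.2]
      simpa using (hT _ _ hne).2

lemma Growable.grow_iterate {κ : Type} [DecidableEq κ] {h : κ → ℕ} {s : Set κ} (H : Growable h s)
    {c : κ} (hc : c ∈ s) (k : ℕ) : Growable (update h c (h c + 2 * k)) s := by
  induction k with
  | zero => simpa using H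
  | succ k ih =>
    convert ih.grow hc using 1
    simp [mul_add, add_assoc]

/-- Cycle colourings can be checked with representatives of the cycles. -/
lemma isCycleColoring_of_root {V κ : Type} [Fintype V] [DecidableEq κ] {g : V → V} {col : V → κ}
    {len : κ → ℕ} (root : κ → V) (N : ℕ) (hs : ∀ q, ∃ p, g p = q) (hi : ∀ p, col (g p) = col p)
    (hr : ∀ p, ∃ n < N, g^[n] (root (col p)) = p)
    (hc : ∀ c, ∑ p, (if col p = c then 1 else 0) = len c) : IsCycleColoring g col len := by
  refine ⟨hs, hi, fun p q hpq => ?_, hc⟩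
  have hg : Bijective g := Finite.surjective_iff_bijective.1 hs
  obtain ⟨n, -, hn⟩ := hr p
  obtain ⟨m, -, hm⟩ := hr q
  refine reach_trans (q := root (col p)) ?_ ⟨m, by rw [hpq, hm]⟩
  obtain ⟨k, hk, hk'⟩ := hg.injective.mem_periodicPts (root (col p))
  refine ⟨k * (n + 1) - n, ?_⟩
  have : k * (n + 1) - n + n = k * (n + 1) :=
    Nat.sub_add_cancel (by nlinarith)
  conv_lhs => rw [← hn]
  rw [← iterate_add_apply, this]
  exact hk'.mul_const (n + 1)

/-- The function on `Fin m` with the given list of values. -/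
def tab {m n : ℕ} [NeZero n] (l : List ℕ) (i : Fin m) : Fin n := Fin.ofNat n (l.getD i 0)

/-- Tables describing a `Core` with `X = Y = Fin m`, `V = Fin (2 * m)`; the matching `I₀` joins
`2 * i` and `2 * i + 1`, and `f false` is the identity. -/
structure Tables (m r : ℕ) where
  h : Fin r → ℕ
  I₁ : List ℕ
  f : List ℕ
  p : List ℕ
  colp : List ℕ
  rootp : List ℕ
  σ : Fin 3 → List ℕ
  col : Fin 3 → List ℕ
  root : Fin 3 → List ℕ

namespace Tables

variable {m r : ℕ} [NeZero m] [NeZero r] (t : Tables m r)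

def left (i : Fin m) : Fin (2 * m) := ⟨i, by omega⟩

def right (i : Fin m) : Fin (2 * m) := ⟨m + i, by omega⟩

def fst : Fin m → Fin m := fun i => Fin.ofNat m (i.1 ^^^ 1)

def snd : Fin m → Fin m := tab t.I₁

def fn (e : Bool) : Fin m → Fin m := bif e then tab t.f else id

def pn : Fin m → Fin m := tab t.p

def fac (k : Fin 3) : Fin (2 * m) → Fin (2 * m) := tab (t.σ k)

def colp' : Fin m → Fin r := tab t.colp

def col' (k : Fin 3) : Fin (2 * m) → Fin r := tab (t.col k)

def rootp' : Fin r → Fin m := tab t.rootp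

def root' (k : Fin 3) : Fin r → Fin (2 * m) := tab (t.root k)

/-- The requirements on the matchings. -/
def ValidMatchings : Prop :=
  (∀ x : Fin m, fst (fst x) = x) ∧
  (∀ x : Fin m, fst x ≠ x) ∧
  (∀ x, t.snd (t.snd x) = x) ∧
  (∀ x, t.snd x ≠ x) ∧
  (∀ y, ∃ x, t.fn true x = y) ∧
  (∀ x, t.fn false x ≠ t.fn true x)

/-- The requirements on the arcs. -/
def ValidArcs : Prop :=
  (∀ x, ∃ k, t.fac k (left x) = left (fst x)) ∧
  (∀ y, ∃ k, t.fac k (right y) = right (t.snd y)) ∧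
  (∀ e x, ∃ k, t.fac k (left x) = right (t.fn e x)) ∧
  (∀ e x, ∃ k, t.fac k (right (t.fn e x)) = left (t.pn x))

/-- The requirements on the cycles. -/
def ValidCycles : Prop :=
  (∀ y, ∃ x, t.pn x = y) ∧
  (∀ x, t.colp' (t.pn x) = t.colp' x) ∧
  (∀ x, ∃ n < m, t.pn^[n] (t.rootp' (t.colp' x)) = x) ∧
  (∀ c, ∑ x, (if t.colp' x = c then 1 else 0) = t.h c) ∧
  (∀ k y, ∃ x, t.fac k x = y) ∧
  (∀ k x, t.col' k (t.fac k x) = t.col' k x) ∧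
  (∀ k x, ∃ n < 2 * m, (t.fac k)^[n] (t.root' k (t.col' k x)) = x) ∧
  (∀ k c, ∑ x, (if t.col' k x = c then 1 else 0) = 2 * t.h c)

def Valid : Prop := t.ValidMatchings ∧ t.ValidArcs ∧ t.ValidCycles

instance : Decidable t.Valid := by
  unfold Valid ValidMatchings ValidArcs ValidCycles
  infer_instance

variable {t}

def Valid.toCore (ht : t.Valid) : Core t.h (Fin m) (Fin m) (Fin (2 * m)) where
  L := left
  R := right
  I₀ := fst
  I₁ := t.snd
  f := t.fn
  p := t.pn
  σ := t.fac
  colp := t.colp'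
  col := t.col'
  bij := by
    constructor
    · rintro (a | a) (b | b) h <;> simp [left, right, Fin.ext_iff] at h ⊢ <;> omega
    · intro v
      by_cases hv : v.1 < m
      · exact ⟨.inl ⟨v, hv⟩, rfl⟩
      · exact ⟨.inr ⟨v - m, by omega⟩, Fin.ext (by simp [right]; omega)⟩
  I₀_invol := ht.1.1
  I₀_ne := ht.1.2.1
  I₁_invol := ht.1.2.2.1
  I₁_ne := ht.1.2.2.2.1
  f_bij := by
    rintro (_ | _)
    · exact bijective_id
    · exact Finite.surjective_iff_bijective.1 ht.1.2.2.2.2.1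
  f_ne := ht.1.2.2.2.2.2
  arc_I₀ := ht.2.1.1
  arc_I₁ := ht.2.1.2.1
  arc_f := ht.2.1.2.2.1
  arc_p := ht.2.1.2.2.2
  cyc_p := isCycleColoring_of_root t.rootp' m ht.2.2.1 ht.2.2.2.1 ht.2.2.2.2.1 ht.2.2.2.2.2.1
  cyc k := isCycleColoring_of_root (t.root' k) (2 * m) (ht.2.2.2.2.2.2.1 k) (ht.2.2.2.2.2.2.2.1 k)
    (ht.2.2.2.2.2.2.2.2.1 k) (ht.2.2.2.2.2.2.2.2.2 k)

end Tables

def tables22 : Tables 2 2 where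
  h := ![1, 1]
  I₁ := [1, 0]
  f := [1, 0]
  p := [0, 1]
  colp := [0, 1]
  rootp := [0, 1]
  σ := ![[1, 0, 3, 2],
    [2, 3, 0, 1],
    [3, 2, 1, 0]]
  col := ![[0, 0, 1, 1],
    [0, 1, 0, 1],
    [0, 1, 1, 0]]
  root := ![[0, 2], [0, 1], [0, 1]]

def tables44 : Tables 4 2 where
  h := ![2, 2]
  I₁ := [2, 3, 0, 1]
  f := [1, 3, 0, 2]
  p := [3, 2, 1, 0]
  colp := [0, 1, 1, 0]
  rootp := [0, 1]
  σ := ![[1, 5, 6, 2, 3, 7, 4, 0],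
    [4, 0, 3, 7, 6, 2, 1, 5],
    [5, 7, 4, 6, 1, 3, 0, 2]]
  col := ![[0, 0, 1, 1, 1, 0, 1, 0],
    [0, 0, 1, 1, 0, 1, 0, 1],
    [0, 1, 1, 0, 1, 0, 0, 1]]
  root := ![[0, 2], [0, 2], [0, 1]]

def tables42222 : Tables 6 5 where
  h := ![2, 1, 1, 1, 1]
  I₁ := [4, 3, 5, 1, 0, 2]
  f := [2, 3, 4, 5, 1, 0]
  p := [0, 1, 2, 4, 3, 5]
  colp := [1, 2, 3, 0, 0, 4]
  rootp := [3, 0, 1, 2, 5]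
  σ := ![[1, 0, 8, 11, 10, 6, 5, 9, 2, 7, 3, 4],
    [6, 7, 10, 9, 5, 4, 0, 3, 11, 1, 2, 8],
    [8, 9, 3, 2, 7, 11, 10, 1, 0, 4, 6, 5]]
  col := ![[1, 1, 2, 0, 0, 3, 3, 4, 2, 4, 0, 0],
    [1, 0, 2, 0, 3, 3, 1, 0, 4, 0, 2, 4],
    [1, 0, 2, 2, 0, 3, 4, 0, 1, 0, 4, 3]]
  root := ![[3, 0, 2, 5, 7], [1, 0, 2, 4, 8], [1, 0, 2, 5, 6]]

def tables822 : Tables 6 3 where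
  h := ![4, 1, 1]
  I₁ := [1, 0, 5, 4, 3, 2]
  f := [2, 4, 1, 5, 0, 3]
  p := [5, 2, 0, 3, 4, 1]
  colp := [0, 0, 0, 1, 2, 0]
  rootp := [0, 3, 4]
  σ := ![[1, 0, 8, 11, 6, 9, 7, 2, 5, 10, 4, 3],
    [6, 7, 3, 2, 10, 4, 5, 0, 11, 1, 9, 8],
    [8, 10, 7, 9, 5, 11, 4, 6, 0, 3, 2, 1]]
  col := ![[1, 1, 0, 2, 0, 0, 0, 0, 0, 0, 0, 2],
    [0, 0, 1, 1, 0, 0, 0, 0, 2, 0, 0, 2],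
    [1, 0, 0, 2, 0, 0, 0, 0, 1, 2, 0, 0]]
  root := ![[2, 0, 3], [0, 2, 8], [1, 0, 3]]

def tables844 : Tables 8 3 where
  h := ![4, 2, 2]
  I₁ := [6, 5, 3, 2, 7, 1, 0, 4]
  f := [4, 7, 5, 6, 0, 1, 3, 2]
  p := [5, 2, 7, 1, 6, 0, 4, 3]
  colp := [1, 0, 0, 0, 2, 1, 2, 0]
  rootp := [1, 0, 4]
  σ := ![[1, 9, 3, 14, 12, 4, 11, 6, 5, 13, 7, 10, 15, 0, 8, 2],
    [8, 0, 10, 11, 5, 13, 7, 15, 14, 2, 3, 4, 6, 9, 1, 12],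
    [12, 15, 13, 2, 8, 9, 14, 10, 6, 0, 11, 1, 5, 7, 4, 3]]
  col := ![[1, 1, 0, 0, 0, 0, 2, 2, 0, 1, 2, 2, 0, 1, 0, 0],
    [1, 1, 0, 0, 0, 0, 2, 2, 1, 0, 0, 0, 2, 0, 1, 2],
    [1, 0, 0, 0, 2, 1, 2, 0, 2, 1, 0, 0, 1, 0, 2, 0]]
  root := ![[2, 0, 6], [2, 0, 6], [1, 0, 4]]

def tables888 : Tables 12 3 where
  h := ![4, 4, 4]
  I₁ := [3, 5, 8, 0, 10, 1, 11, 9, 2, 7, 4, 6]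
  f := [9, 11, 8, 7, 5, 1, 2, 6, 3, 0, 4, 10]
  p := [11, 9, 4, 2, 7, 1, 10, 3, 5, 8, 0, 6]
  colp := [0, 1, 2, 2, 2, 1, 0, 2, 1, 1, 0, 0]
  rootp := [0, 1, 2]
  σ := ![[1, 23, 3, 15, 5, 13, 14, 6, 9, 21, 11, 22, 8, 17, 20, 12, 0, 7, 10, 2, 4, 19, 16, 18],
    [12, 13, 14, 19, 17, 4, 7, 18, 20, 8, 16, 23, 15, 9, 10, 2, 22, 1, 3, 21, 5, 11, 0, 6],
    [21, 0, 20, 2, 16, 17, 18, 19, 15, 12, 22, 10, 11, 1, 4, 5, 7, 13, 23, 3, 14, 8, 6, 9]]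
  col := ![[0, 0, 1, 1, 2, 2, 2, 2, 1, 1, 0, 0, 1, 2, 2, 1, 0, 2, 0, 1, 2, 1, 0, 0],
    [0, 1, 0, 2, 1, 1, 2, 2, 1, 1, 0, 2, 0, 1, 0, 0, 0, 1, 2, 2, 1, 2, 0, 2],
    [0, 0, 1, 1, 1, 0, 2, 1, 0, 2, 2, 2, 2, 0, 1, 0, 1, 0, 2, 1, 1, 0, 2, 2]]
  root := ![[0, 2, 4], [0, 1, 3], [0, 2, 6]]

def tables62 : Tables 4 2 where
  h := ![3, 1]
  I₁ := [2, 3, 0, 1]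
  f := [1, 0, 3, 2]
  p := [1, 3, 2, 0]
  colp := [0, 0, 1, 0]
  rootp := [0, 2]
  σ := ![[1, 4, 6, 2, 3, 7, 0, 5],
    [4, 5, 3, 7, 6, 1, 2, 0],
    [5, 0, 7, 6, 1, 3, 4, 2]]
  col := ![[0, 0, 0, 0, 0, 1, 0, 1],
    [0, 1, 0, 0, 0, 1, 0, 0],
    [0, 0, 1, 0, 0, 0, 0, 1]]
  root := ![[0, 5], [0, 1], [0, 2]]

def tables84 : Tables 6 2 where
  h := ![4, 2]
  I₁ := [1, 0, 4, 5, 2, 3]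
  f := [5, 0, 4, 2, 3, 1]
  p := [5, 2, 0, 4, 3, 1]
  colp := [0, 0, 0, 1, 1, 0]
  rootp := [0, 3]
  σ := ![[1, 7, 3, 8, 9, 4, 2, 6, 10, 11, 0, 5],
    [6, 0, 10, 2, 5, 11, 7, 1, 4, 3, 8, 9],
    [11, 6, 8, 9, 10, 7, 5, 2, 0, 4, 3, 1]]
  col := ![[0, 0, 0, 0, 1, 1, 0, 0, 0, 1, 0, 1],
    [1, 1, 0, 0, 0, 0, 1, 1, 0, 0, 0, 0],
    [0, 0, 0, 1, 1, 0, 0, 0, 0, 1, 1, 0]]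
  root := ![[0, 4], [2, 0], [0, 3]]

def tables88 : Tables 8 2 where
  h := ![4, 4]
  I₁ := [7, 3, 6, 1, 5, 4, 2, 0]
  f := [5, 0, 4, 6, 2, 7, 3, 1]
  p := [7, 6, 1, 0, 2, 3, 4, 5]
  colp := [0, 1, 1, 0, 1, 0, 1, 0]
  rootp := [0, 1]
  σ := ![[1, 8, 10, 2, 12, 4, 11, 6, 15, 5, 14, 9, 13, 7, 0, 3],
    [8, 9, 12, 11, 10, 13, 14, 15, 7, 6, 2, 0, 1, 3, 4, 5],
    [13, 0, 3, 14, 5, 15, 7, 9, 6, 11, 1, 4, 2, 12, 10, 8]]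
  col := ![[0, 0, 0, 0, 1, 1, 1, 1, 0, 1, 0, 1, 1, 1, 0, 0],
    [0, 1, 1, 0, 1, 0, 1, 0, 0, 1, 1, 0, 1, 0, 1, 0],
    [0, 0, 0, 0, 1, 1, 1, 1, 1, 1, 0, 1, 0, 0, 0, 1]]
  root := ![[0, 4], [0, 1], [0, 4]]

def tables12 : Tables 6 1 where
  h := ![6]
  I₁ := [3, 4, 5, 0, 1, 2]
  f := [3, 0, 5, 1, 2, 4]
  p := [3, 2, 4, 1, 5, 0]
  colp := [0, 0, 0, 0, 0, 0]
  rootp := [0]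
  σ := ![[1, 6, 8, 7, 10, 11, 9, 2, 5, 3, 0, 4],
    [6, 7, 3, 9, 8, 4, 2, 10, 11, 1, 5, 0],
    [9, 0, 11, 2, 5, 10, 3, 1, 4, 6, 7, 8]]
  col := ![[0, 0, 0, 0, 0, 0, 0, 0, 0, 0, 0, 0],
    [0, 0, 0, 0, 0, 0, 0, 0, 0, 0, 0, 0],
    [0, 0, 0, 0, 0, 0, 0, 0, 0, 0, 0, 0]]
  root := ![[0], [0], [0]]

def tables66 : Tables 6 2 where
  h := ![3, 3]
  I₁ := [5, 2, 1, 4, 3, 0]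
  f := [1, 4, 5, 2, 0, 3]
  p := [1, 5, 4, 2, 3, 0]
  colp := [0, 0, 1, 1, 1, 0]
  rootp := [0, 2]
  σ := ![[1, 7, 11, 9, 6, 4, 3, 8, 2, 10, 5, 0],
    [6, 10, 8, 2, 5, 9, 11, 1, 7, 0, 3, 4],
    [7, 0, 3, 8, 10, 11, 1, 5, 4, 2, 9, 6]]
  col := ![[0, 0, 0, 1, 1, 1, 1, 0, 0, 1, 1, 0],
    [0, 1, 1, 1, 0, 0, 0, 1, 1, 0, 1, 0],
    [1, 1, 0, 0, 0, 1, 1, 1, 0, 0, 0, 1]]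
  root := ![[0, 3], [0, 1], [2, 0]]

def tables664 : Tables 8 3 where
  h := ![3, 3, 2]
  I₁ := [1, 0, 7, 6, 5, 4, 3, 2]
  f := [7, 5, 0, 6, 3, 4, 1, 2]
  p := [1, 3, 4, 0, 2, 7, 5, 6]
  colp := [0, 0, 2, 0, 2, 1, 1, 1]
  rootp := [0, 5, 2]
  σ := ![[1, 13, 8, 11, 12, 4, 7, 15, 9, 5, 6, 14, 2, 3, 0, 10],
    [8, 9, 10, 2, 11, 13, 14, 6, 4, 3, 15, 0, 7, 12, 5, 1],
    [15, 0, 3, 14, 5, 12, 9, 10, 1, 8, 4, 2, 13, 7, 11, 6]]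
  col := ![[0, 0, 1, 0, 1, 1, 2, 2, 1, 1, 2, 0, 1, 0, 0, 2],
    [2, 0, 0, 0, 2, 1, 1, 1, 2, 0, 0, 2, 1, 1, 1, 0],
    [0, 0, 2, 2, 1, 1, 0, 1, 0, 0, 1, 2, 1, 1, 2, 0]]
  root := ![[0, 2, 6], [1, 5, 0], [0, 4, 2]]

lemma IsCycleColoring.sum {V₁ V₂ κ₁ κ₂ : Type} [Fintype V₁] [Fintype V₂] [DecidableEq κ₁]
    [DecidableEq κ₂] {g₁ : V₁ → V₁} {g₂ : V₂ → V₂} {col₁ : V₁ → κ₁} {col₂ : V₂ → κ₂}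
    {len : κ₁ ⊕ κ₂ → ℕ} (h₁ : IsCycleColoring g₁ col₁ fun c => len (.inl c))
    (h₂ : IsCycleColoring g₂ col₂ fun c => len (.inr c)) :
    IsCycleColoring (Sum.map g₁ g₂) (Sum.map col₁ col₂) len := by
  obtain ⟨hs₁, hi₁, ht₁, hc₁⟩ := h₁
  obtain ⟨hs₂, hi₂, ht₂, hc₂⟩ := h₂
  have hl : ∀ n p, (Sum.map g₁ g₂)^[n] (.inl p) = .inl (g₁^[n] p) := by
    intro n
    induction n with
    | zero => simp
    | succ n ih => intro p; simp only [iterate_succ_apply, Sum.map_inl, ih]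
  have hr : ∀ n p, (Sum.map g₁ g₂)^[n] (.inr p) = .inr (g₂^[n] p) := by
    intro n
    induction n with
    | zero => simp
    | succ n ih => intro p; simp only [iterate_succ_apply, Sum.map_inr, ih]
  refine ⟨Sum.map_surjective.2 ⟨hs₁, hs₂⟩, ?_, ?_, ?_⟩
  · rintro (p | p) <;> simp [hi₁, hi₂]
  · rintro (p | p) (q | q) h <;> simp at h
    · obtain ⟨n, rfl⟩ := ht₁ p q h
      exact ⟨n, hl n p⟩
    · obtain ⟨n, rfl⟩ := ht₂ p q h
      exact ⟨n, hr n p⟩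
  · rintro (c | c) <;> rw [Fintype.sum_sum_type] <;> simp only [Sum.map_inl, Sum.map_inr,
      Sum.inl.injEq, Sum.inr.injEq, reduceCtorEq, if_false, Finset.sum_const_zero, zero_add,
      add_zero]
    exacts [hc₁ c, hc₂ c]

/-- The disjoint union of two `Core`s. -/
def Core.sum {κ₁ κ₂ : Type} [DecidableEq κ₁] [DecidableEq κ₂] {h₁ : κ₁ → ℕ} {h₂ : κ₂ → ℕ}
    {X₁ Y₁ V₁ X₂ Y₂ V₂ : Type} [Fintype X₁] [Fintype Y₁] [Fintype V₁] [Fintype X₂] [Fintype Y₂]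
    [Fintype V₂] (D : Core h₁ X₁ Y₁ V₁) (E : Core h₂ X₂ Y₂ V₂) :
    Core (Sum.elim h₁ h₂) (X₁ ⊕ X₂) (Y₁ ⊕ Y₂) (V₁ ⊕ V₂) where
  L := Sum.map D.L E.L
  R := Sum.map D.R E.R
  I₀ := Sum.map D.I₀ E.I₀
  I₁ := Sum.map D.I₁ E.I₁
  f e := Sum.map (D.f e) (E.f e)
  p := Sum.map D.p E.p
  σ k := Sum.map (D.σ k) (E.σ k)
  colp := Sum.map D.colp E.colp
  col k := Sum.map (D.col k) (E.col k)
  bij := by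
    constructor
    · rintro ((a | a) | (a | a)) ((b | b) | (b | b)) h <;>
        simp_all [D.L_inj.eq_iff, D.R_inj.eq_iff, D.L_ne_R, (D.L_ne_R _ _).symm,
          E.L_inj.eq_iff, E.R_inj.eq_iff, E.L_ne_R, (E.L_ne_R _ _).symm]
    · rintro (v | v)
      · rcases D.cases_LR v with ⟨x, rfl⟩ | ⟨y, rfl⟩
        exacts [⟨.inl (.inl x), rfl⟩, ⟨.inr (.inl y), rfl⟩]
      · rcases E.cases_LR v with ⟨x, rfl⟩ | ⟨y, rfl⟩
        exacts [⟨.inl (.inr x), rfl⟩, ⟨.inr (.inr y), rfl⟩]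
  I₀_invol := by rintro (x | x) <;> simp [D.I₀_invol, E.I₀_invol]
  I₀_ne := by rintro (x | x) <;> simp [D.I₀_ne, E.I₀_ne]
  I₁_invol := by rintro (x | x) <;> simp [D.I₁_invol, E.I₁_invol]
  I₁_ne := by rintro (x | x) <;> simp [D.I₁_ne, E.I₁_ne]
  f_bij e := Sum.map_bijective.2 ⟨D.f_bij e, E.f_bij e⟩
  f_ne := by rintro (x | x) <;> simp [D.f_ne, E.f_ne]
  arc_I₀ := by rintro (x | x) <;> simp [D.arc_I₀, E.arc_I₀]
  arc_I₁ := by rintro (x | x) <;> simp [D.arc_I₁, E.arc_I₁]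
  arc_f := by rintro e (x | x) <;> simp [D.arc_f, E.arc_f]
  arc_p := by rintro e (x | x) <;> simp [D.arc_p, E.arc_p]
  cyc_p := .sum D.cyc_p E.cyc_p
  cyc k := .sum (D.cyc k) (E.cyc k)

/-- There is a `Core` whose factors have cycles of the lengths in `μ`. -/
def HasCore (μ : Multiset ℕ) : Prop :=
  ∃ (κ : Type) (_ : Fintype κ) (_ : DecidableEq κ) (h : κ → ℕ) (X Y V : Type) (_ : Fintype X)
    (_ : Fintype Y) (_ : Fintype V), Nonempty (Core h X Y V) ∧
    Finset.univ.val.map (fun c => 2 * h c) = μ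

lemma HasCore.add {μ ν : Multiset ℕ} (hμ : HasCore μ) (hν : HasCore ν) : HasCore (μ + ν) := by
  obtain ⟨κ, _, _, h, X, Y, V, _, _, _, ⟨D⟩, rfl⟩ := hμ
  obtain ⟨κ', _, _, h', X', Y', V', _, _, _, ⟨E⟩, rfl⟩ := hν
  refine ⟨κ ⊕ κ', inferInstance, inferInstance, Sum.elim h h', _, _, _, inferInstance,
    inferInstance, inferInstance, ⟨D.sum E⟩, ?_⟩
  simp [← Finset.univ_disjSum_univ, Finset.disjSum, Multiset.disjSum, Function.comp_def]

lemma HasCore.nsmul {μ : Multiset ℕ} (hμ : HasCore μ) {k : ℕ} (hk : 0 < k) : HasCore (k • μ) := by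
  induction k, hk using Nat.le_induction with
  | base => simpa using hμ
  | succ k _ ih => rw [succ_nsmul]; exact ih.add hμ

lemma Growable.hasCore {κ : Type} [Fintype κ] [DecidableEq κ] {h : κ → ℕ} {s : Set κ}
    (H : Growable h s) : HasCore (Finset.univ.val.map fun c => 2 * h c) := by
  obtain ⟨X, Y, V, _, _, _, D, -⟩ := H
  exact ⟨κ, _, _, h, X, Y, V, _, _, _, ⟨D⟩, rfl⟩

namespace Core

variable {κ : Type} [DecidableEq κ] {h : κ → ℕ} {X Y V : Type} [Fintype X] [Fintype Y] [Fintype V]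

lemma growable_one {D : Core h X Y V} {c : κ} (S : Site D c) : Growable h {c} :=
  ⟨X, Y, V, _, _, _, D, fun d => (Set.mem_singleton_iff.1 d.2).symm ▸ S,
    fun d d' h => absurd (Subsingleton.elim d d') h⟩

lemma growable_two {D : Core h X Y V} {c d : κ} (S : Site D c) (T : Site D d) (hcd : c ≠ d)
    (hST : S.x ≠ T.x ∧ D.p S.x ≠ T.v) (hTS : T.x ≠ S.x ∧ D.p T.x ≠ S.v) :
    Growable h {c, d} := by
  refine ⟨X, Y, V, _, _, _, D, fun e => if he : (e : κ) = c then he.symm ▸ S else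
    (Set.mem_singleton_iff.1 (e.2.resolve_left he)).symm ▸ T, ?_⟩
  rintro ⟨e, he⟩ ⟨e', he'⟩ hne
  by_cases h₁ : e = c
  · subst h₁
    obtain rfl : e' = d := he'.resolve_left fun h => hne (by simp [h.symm])
    simpa [hcd.symm] using hST
  · obtain rfl : e = d := he.resolve_left h₁
    obtain rfl : e' = c := he'.resolve_right fun h => hne (by simp [Set.mem_singleton_iff.1 h])
    simpa [hcd.symm] using hTS

end Core

lemma valid_tables22 : tables22.Valid := by decide +kernel

lemma valid_tables44 : tables44.Valid := by decide +kernel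

lemma valid_tables42222 : tables42222.Valid := by decide +kernel

lemma valid_tables822 : tables822.Valid := by decide +kernel

lemma valid_tables844 : tables844.Valid := by decide +kernel

lemma valid_tables888 : tables888.Valid := by decide +kernel

lemma valid_tables62 : tables62.Valid := by decide +kernel

def site62 : Site valid_tables62.toCore 0 where
  x := 0
  v := 3
  e := false
  A := 1
  B := 2
  C := 0
  hAB := by decide +kernel
  hAC := by decide +kernel
  hBC := by decide +kernel
  hA := by decide +kernel
  hB := by decide +kernel
  hv := by decide +kernel
  hne := by decide +kernel
  colA := by decide +kernel
  colB := by decide +kernel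
  colB' := by decide +kernel
  colC := by decide +kernel
  colv := by decide +kernel

lemma valid_tables84 : tables84.Valid := by decide +kernel

def site84 : Site valid_tables84.toCore 0 where
  x := 2
  v := 2
  e := true
  A := 1
  B := 0
  C := 2
  hAB := by decide +kernel
  hAC := by decide +kernel
  hBC := by decide +kernel
  hA := by decide +kernel
  hB := by decide +kernel
  hv := by decide +kernel
  hne := by decide +kernel
  colA := by decide +kernel
  colB := by decide +kernel
  colB' := by decide +kernel
  colC := by decide +kernel
  colv := by decide +kernel

lemma valid_tables88 : tables88.Valid := by decide +kernel

def site88 : Site valid_tables88.toCore 0 where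
  x := 3
  v := 3
  e := true
  A := 2
  B := 0
  C := 1
  hAB := by decide +kernel
  hAC := by decide +kernel
  hBC := by decide +kernel
  hA := by decide +kernel
  hB := by decide +kernel
  hv := by decide +kernel
  hne := by decide +kernel
  colA := by decide +kernel
  colB := by decide +kernel
  colB' := by decide +kernel
  colC := by decide +kernel
  colv := by decide +kernel

lemma valid_tables12 : tables12.Valid := by decide +kernel

def site12 : Site valid_tables12.toCore 0 where
  x := 4
  v := 1
  e := false
  A := 0
  B := 1
  C := 2
  hAB := by decide +kernel
  hAC := by decide +kernel
  hBC := by decide +kernel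
  hA := by decide +kernel
  hB := by decide +kernel
  hv := by decide +kernel
  hne := by decide +kernel
  colA := by decide +kernel
  colB := by decide +kernel
  colB' := by decide +kernel
  colC := by decide +kernel
  colv := by decide +kernel

lemma valid_tables66 : tables66.Valid := by decide +kernel

def site66_a : Site valid_tables66.toCore 0 where
  x := 3
  v := 0
  e := true
  A := 2
  B := 0
  C := 1
  hAB := by decide +kernel
  hAC := by decide +kernel
  hBC := by decide +kernel
  hA := by decide +kernel
  hB := by decide +kernel
  hv := by decide +kernel
  hne := by decide +kernel
  colA := by decide +kernel
  colB := by decide +kernel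
  colB' := by decide +kernel
  colC := by decide +kernel
  colv := by decide +kernel

def site66_b : Site valid_tables66.toCore 1 where
  x := 0
  v := 3
  e := true
  A := 2
  B := 1
  C := 0
  hAB := by decide +kernel
  hAC := by decide +kernel
  hBC := by decide +kernel
  hA := by decide +kernel
  hB := by decide +kernel
  hv := by decide +kernel
  hne := by decide +kernel
  colA := by decide +kernel
  colB := by decide +kernel
  colB' := by decide +kernel
  colC := by decide +kernel
  colv := by decide +kernel

lemma valid_tables664 : tables664.Valid := by decide +kernel

def site664_a : Site valid_tables664.toCore 0 where
  x := 0
  v := 3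
  e := true
  A := 2
  B := 1
  C := 0
  hAB := by decide +kernel
  hAC := by decide +kernel
  hBC := by decide +kernel
  hA := by decide +kernel
  hB := by decide +kernel
  hv := by decide +kernel
  hne := by decide +kernel
  colA := by decide +kernel
  colB := by decide +kernel
  colB' := by decide +kernel
  colC := by decide +kernel
  colv := by decide +kernel

def site664_b : Site valid_tables664.toCore 1 where
  x := 5
  v := 5
  e := true
  A := 2
  B := 1
  C := 0
  hAB := by decide +kernel
  hAC := by decide +kernel
  hBC := by decide +kernel
  hA := by decide +kernel
  hB := by decide +kernel
  hv := by decide +kernel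
  hne := by decide +kernel
  colA := by decide +kernel
  colB := by decide +kernel
  colB' := by decide +kernel
  colC := by decide +kernel
  colv := by decide +kernel

lemma hasCore_of_tables {m r : ℕ} [NeZero m] [NeZero r] {t : Tables m r} (ht : t.Valid) :
    HasCore (Finset.univ.val.map fun c => 2 * t.h c) :=
  ⟨Fin r, _, _, t.h, _, _, _, _, _, _, ⟨ht.toCore⟩, rfl⟩

lemma hasCore_2_2 : HasCore {2, 2} := hasCore_of_tables valid_tables22

lemma hasCore_4_4 : HasCore {4, 4} := hasCore_of_tables valid_tables44

lemma hasCore_4_2_2_2_2 : HasCore {4, 2, 2, 2, 2} := hasCore_of_tables valid_tables42222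

lemma hasCore_8_2_2 : HasCore {8, 2, 2} := hasCore_of_tables valid_tables822

lemma hasCore_8_4_4 : HasCore {8, 4, 4} := hasCore_of_tables valid_tables844

lemma hasCore_8_8_8 : HasCore {8, 8, 8} := hasCore_of_tables valid_tables888

lemma hasCore_six_two (k : ℕ) : HasCore {6 + 4 * k, 2} := by
  have := ((Core.growable_one site62).grow_iterate (Set.mem_singleton _) k).hasCore
  convert this using 1
  simp [tables62]
  ring_nf
  rfl

lemma hasCore_eight_four (k : ℕ) : HasCore {8 + 4 * k, 4} := by
  have := ((Core.growable_one site84).grow_iterate (Set.mem_singleton _) k).hasCore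
  convert this using 1
  simp [tables84]
  ring_nf
  rfl

lemma hasCore_eight_eight (k : ℕ) : HasCore {8 + 4 * k, 8} := by
  have := ((Core.growable_one site88).grow_iterate (Set.mem_singleton _) k).hasCore
  convert this using 1
  simp [tables88]
  ring_nf
  rfl

lemma hasCore_twelve (k : ℕ) : HasCore {12 + 4 * k} := by
  have := ((Core.growable_one site12).grow_iterate (Set.mem_singleton _) k).hasCore
  convert this using 1
  simp [tables12]
  ring

lemma hasCore_six_six (k l : ℕ) : HasCore {6 + 4 * k, 6 + 4 * l} := by
  have := (((Core.growable_two site66_a site66_b (by decide) (by decide +kernel)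
    (by decide +kernel)).grow_iterate (c := 0) (by simp) k).grow_iterate
      (c := 1) (by simp) l).hasCore
  convert this using 1
  simp [tables66]
  ring_nf
  rfl

lemma hasCore_six_six_four (k l : ℕ) : HasCore {6 + 4 * k, 6 + 4 * l, 4} := by
  have := (((Core.growable_two site664_a site664_b (by decide) (by decide +kernel)
    (by decide +kernel)).grow_iterate (c := 0) (by simp) k).grow_iterate
      (c := 1) (by simp) l).hasCore
  convert this using 1
  simp [tables664]
  ring_nf
  rfl

lemma hasCore_pair {r : ℕ} (hr : 2 ≤ r) (hre : Even r) : HasCore {r, r} := by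
  obtain ⟨q, rfl⟩ := hre
  rcases Nat.even_or_odd' q with ⟨j, rfl | rfl⟩
  · obtain rfl | rfl | hj : j = 1 ∨ j = 2 ∨ 3 ≤ j := by omega
    · exact hasCore_4_4
    · exact hasCore_eight_eight 0
    · obtain ⟨i, rfl⟩ := Nat.exists_eq_add_of_le hj
      convert (hasCore_twelve i).add (hasCore_twelve i) using 1
      ring_nf
      rfl
  · rcases j with _ | j
    · exact hasCore_2_2
    · convert hasCore_six_six j j using 1
      ring_nf

lemma HasCore.add_replicate {μ : Multiset ℕ} (hμ : HasCore μ) {r : ℕ} (hr : 2 ≤ r) (hre : Even r)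
    (k : ℕ) : HasCore (μ + Multiset.replicate (2 * k) r) := by
  rcases Nat.eq_zero_or_pos k with rfl | hk
  · simpa using hμ
  · convert hμ.add ((hasCore_pair hr hre).nsmul hk) using 2
    rw [mul_comm, ← Multiset.nsmul_replicate]
    rfl

lemma hasCore_replicate_even {r : ℕ} (hr : 2 ≤ r) (hre : Even r) {k : ℕ} (hk : 0 < k) :
    HasCore (Multiset.replicate (2 * k) r) := by
  convert (hasCore_pair hr hre).nsmul hk using 1
  rw [mul_comm, ← Multiset.nsmul_replicate]
  rfl

open Multiset (replicate)

lemma HasCore.extend {i j s t : ℕ} (h : HasCore (replicate i s + replicate j t)) (hs : 2 ≤ s)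
    (ht : 2 ≤ t) (hse : Even s) (hte : Even t) (k l : ℕ) :
    HasCore (replicate (2 * k + i) s + replicate (2 * l + j) t) := by
  convert (h.add_replicate hs hse k).add_replicate ht hte l using 1
  simp only [Multiset.replicate_add]
  abel

lemma HasCore.extend_left {i s t : ℕ} (h : HasCore (replicate i s)) (hs : 2 ≤ s)
    (ht : 2 ≤ t) (hse : Even s) (hte : Even t) (k l : ℕ) :
    HasCore (replicate (2 * k + i) s + replicate (2 * l) t) :=
  HasCore.extend (j := 0) (by simpa using h) hs ht hse hte k l

lemma hasCore_single {s : ℕ} (hs : 12 ≤ s) (hs4 : s % 4 = 0) : HasCore {s} := by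
  obtain ⟨i, rfl⟩ : ∃ i, s = 12 + 4 * i := ⟨(s - 12) / 4, by omega⟩
  exact hasCore_twelve i

lemma hasCore_odd_even {k l s t : ℕ} (hl : 0 < l) (hs : 2 ≤ s) (ht : 2 ≤ t) (hse : Even s)
    (hte : Even t) (h : (2 * k + 1) * s = 2 * l * t) (hex : ¬ (k = 0 ∧ s = 4 ∧ t = 2)) :
    HasCore (replicate (2 * k + 1) s + replicate (2 * l) t) := by
  have hs4 : s % 4 = 0 := by
    obtain ⟨q, rfl⟩ := hte
    have : s + 2 * (k * s) = 4 * (l * q) := by linarith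
    obtain ⟨p, rfl⟩ := hse
    have : p + 2 * (k * p) = 2 * (l * q) := by linarith
    omega
  obtain rfl | rfl | hs12 : s = 4 ∨ s = 8 ∨ 12 ≤ s := by omega
  · rcases k with _ | k
    · have : l * t = 2 := by linarith
      have : t ∣ 2 := ⟨l, by linarith⟩
      have := Nat.le_of_dvd (by norm_num) this
      omega
    · obtain ⟨q, rfl⟩ := hte
      have hl' : 2 * k + 3 = l * q := by linarith
      have hq : q % 2 = 1 := by
        rcases Nat.even_or_odd' q with ⟨j, rfl | rfl⟩
        · have : l * (2 * j) = 2 * (l * j) := by ring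
          omega
        · omega
      obtain rfl | hq3 : q = 1 ∨ 3 ≤ q := by omega
      · obtain ⟨m, rfl⟩ : ∃ m, l = m + 2 := ⟨l - 2, by omega⟩
        exact HasCore.extend (i := 1) (j := 4) hasCore_4_2_2_2_2 hs ht hse (by decide) (k + 1) m
      · obtain ⟨m, rfl⟩ : ∃ m, l = m + 1 := ⟨l - 1, by omega⟩
        obtain ⟨i, rfl⟩ : ∃ i, q = 2 * i + 3 := ⟨(q - 3) / 2, by omega⟩
        rw [add_comm]
        refine HasCore.extend (i := 2) (j := 1) ?_ ht hs ⟨_, rfl⟩ hse m (k + 1)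
        convert hasCore_six_six_four i i using 1
        ring_nf
        rfl
  · rcases k with _ | k
    · have h4 : l * t = 4 := by linarith
      have ht4 : t ∣ 4 := ⟨l, by linarith⟩
      have := Nat.le_of_dvd (by norm_num) ht4
      obtain rfl | rfl : t = 2 ∨ t = 4 := by
        obtain ⟨q, rfl⟩ := hte
        omega
      · obtain rfl : l = 2 := by omega
        exact HasCore.extend (i := 1) (j := 2) hasCore_8_2_2 hs ht hse hte 0 1
      · obtain rfl : l = 1 := by omega
        exact hasCore_8_4_4
    · exact HasCore.extend_left (i := 3) hasCore_8_8_8 hs ht hse hte k l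
  · exact HasCore.extend_left (i := 1) (hasCore_single hs12 hs4) hs ht hse hte k l

/-- Cores with two cycles of even lengths congruent modulo 4. -/
lemma hasCore_mixed {s t : ℕ} (hs : 2 ≤ s) (hst : s ≤ t) (hse : Even s)
    (h4 : s % 4 = t % 4) (hex : ¬ (s = 4 ∧ t = 8)) : HasCore {t, s} := by
  obtain ⟨p, rfl⟩ := hse
  obtain ⟨d, rfl⟩ : ∃ d, t = p + p + 4 * d := ⟨(t - (p + p)) / 4, by omega⟩
  rcases Nat.even_or_odd' p with ⟨i, rfl | rfl⟩
  · obtain rfl | rfl | hi : i = 1 ∨ i = 2 ∨ 3 ≤ i := by omega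
    · rcases d with _ | _ | d
      · exact hasCore_4_4
      · omega
      · convert hasCore_eight_four (d + 1) using 2
        ring
    · convert hasCore_eight_eight d using 2
    · exact (hasCore_single (s := 2 * i + 2 * i + 4 * d) (by omega) (by omega)).add
        (hasCore_single (s := 2 * i + 2 * i) (by omega) (by omega))
  · rcases i with _ | i
    · rcases d with _ | d
      · exact hasCore_2_2
      · convert hasCore_six_two d using 2
        ring
    · convert hasCore_six_six (i + d) i using 2
      · ring
      · ring_nf

lemma hasCore_odd_odd {k l s t : ℕ} (hs : 2 ≤ s) (hst : s ≤ t) (hse : Even s)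
    (hte : Even t) (h : (2 * k + 1) * s = (2 * l + 1) * t) :
    HasCore (replicate (2 * k + 1) s + replicate (2 * l + 1) t) := by
  rw [add_comm]
  refine HasCore.extend (i := 1) (j := 1) (hasCore_mixed hs hst hse ?_ ?_) (hs.trans hst) hs hte
    hse l k
  · obtain ⟨p, rfl⟩ := hse
    obtain ⟨q, rfl⟩ := hte
    have : 2 * (k * p) + p = 2 * (l * q) + q := by linarith
    omega
  · rintro ⟨rfl, rfl⟩
    omega

lemma hasCore_main {a b s t : ℕ} (ha : 0 < a) (hb : 0 < b) (hs : 2 ≤ s) (ht : 2 ≤ t)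
    (hse : Even s) (hte : Even t) (h : a * s = b * t) (hex : ¬ (a = 1 ∧ s = 4 ∧ t = 2))
    (hex' : ¬ (b = 1 ∧ t = 4 ∧ s = 2)) : HasCore (replicate a s + replicate b t) := by
  rcases Nat.even_or_odd' a with ⟨k, rfl | rfl⟩ <;> rcases Nat.even_or_odd' b with ⟨l, rfl | rfl⟩
  · exact (hasCore_replicate_even hs hse (by omega)).add_replicate ht hte l
  · rw [add_comm]
    exact hasCore_odd_even (by omega) ht hs hte hse h.symm (by omega)
  · exact hasCore_odd_even (by omega) hs ht hse hte h (by omega)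
  · rcases le_total s t with hst | hst
    · exact hasCore_odd_odd hs hst hse hte h
    · rw [add_comm]
      exact hasCore_odd_odd ht hst hte hse h.symm

open Equiv

lemma ne_of_cycleType_sum {V : Type*} [Fintype V] [DecidableEq V] {σ : Perm V}
    (h : σ.cycleType.sum = Fintype.card V) (x : V) : σ x ≠ x := by
  rw [Perm.sum_cycleType] at h
  exact Perm.mem_support.1 (by rw [(Finset.card_eq_iff_eq_univ _).1 h]; exact Finset.mem_univ x)

lemma cycleType_permCongr {V W : Type*} [Fintype V] [DecidableEq V] [Fintype W] [DecidableEq W]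
    (e : V ≃ W) (σ : Perm V) : (e.permCongr σ).cycleType = σ.cycleType := by
  have : e.permCongr σ = σ.extendDomain
      (e.trans (subtypeUnivEquiv fun _ => trivial).symm : V ≃ {_z : W // True}) := by
    ext z
    rw [Perm.extendDomain_apply_subtype _ _ trivial]
    simp [subtypeUnivEquiv]
  rw [this, Perm.cycleType_extendDomain]

lemma hasOPSolution_of_cover {V ι : Type*} [Fintype V] [DecidableEq V] [Fintype ι] {m : List ℕ}
    (hV : Fintype.card V = m.sum) (hι : Fintype.card ι + 1 = m.sum) (τ : ι → Perm V)
    (hτ : ∀ i, (τ i).cycleType = (m : Multiset ℕ)) (hc : ∀ x y, x ≠ y → ∃ i, τ i x = y) :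
    HasOPSolution m := by
  have hne : ∀ i x, τ i x ≠ x := fun i => ne_of_cycleType_sum (by rw [hτ, hV]; simp)
  have hinj : ∀ x, Injective fun i => τ i x := by
    intro x
    let g : ι → {y // y ≠ x} := fun i => ⟨τ i x, hne i x⟩
    have hg : Surjective g := fun ⟨y, hy⟩ => by
      obtain ⟨i, hi⟩ := hc x y hy.symm
      exact ⟨i, Subtype.ext hi⟩
    have hg' : Bijective g := by
      rw [Fintype.bijective_iff_surjective_and_card]
      refine ⟨hg, ?_⟩
      rw [Fintype.card_subtype_compl, Fintype.card_subtype_eq]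
      omega
    exact fun i j hij => hg'.1 (Subtype.ext hij)
  let e : V ≃ Fin m.sum := Fintype.equivFinOfCardEq hV
  let e' : ι ≃ Fin (m.sum - 1) := Fintype.equivFinOfCardEq (by omega)
  refine ⟨fun i => e.permCongr (τ (e'.symm i)), fun i => ?_, fun x y hxy => ?_⟩
  · rw [cycleType_permCongr, hτ]
  · obtain ⟨i, hi⟩ := hc (e.symm x) (e.symm y) (by simpa using hxy)
    refine ⟨e' i, by simp [hi], fun j hj => ?_⟩
    have : τ (e'.symm j) (e.symm x) = τ i (e.symm x) := by
      rw [hi, ← hj]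
      simp
    rw [← hinj _ this]
    simp

lemma cycleType_eq_replicate {V : Type*} [Fintype V] [DecidableEq V] {σ : Perm V} {t b : ℕ}
    (ht : 2 ≤ t) (hV : Fintype.card V = b * t) (h : ∀ x k, (σ ^ k) x = x ↔ t ∣ k) :
    σ.cycleType = Multiset.replicate b t := by
  have hall : ∀ l ∈ σ.cycleType, l = t := by
    intro l hl
    rw [Perm.cycleType_def, Multiset.mem_map] at hl
    obtain ⟨c, hc, rfl⟩ := hl
    have hc' : c ∈ σ.cycleFactorsFinset := hc
    have hcyc := (Perm.mem_cycleFactorsFinset_iff.1 hc').1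
    obtain ⟨x, hx⟩ := Finset.card_pos.1 (by have := hcyc.two_le_card_support; omega :
      0 < c.support.card)
    have key : ∀ k, t ∣ k ↔ orderOf c ∣ k := by
      intro k
      rw [← h x k, orderOf_dvd_iff_pow_eq_one, hcyc.pow_eq_one_iff' (Perm.mem_support.1 hx)]
      have : (σ ^ k) x = (c ^ k) x := by
        rw [Perm.cycle_is_cycleOf hx hc', Perm.cycleOf_pow_apply_self]
      rw [this]
    rw [Function.comp, ← hcyc.orderOf]
    exact Nat.dvd_antisymm ((key _).1 dvd_rfl) ((key _).2 dvd_rfl)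
  have hsum : σ.cycleType.sum = Fintype.card V := by
    rw [Perm.sum_cycleType, Finset.card_eq_iff_eq_univ, Finset.eq_univ_iff_forall]
    intro x
    rw [Perm.mem_support]
    intro hx
    have := Nat.le_of_dvd one_pos ((h x 1).1 (by simpa using hx))
    omega
  rw [Multiset.eq_replicate]
  refine ⟨?_, hall⟩
  rw [Multiset.eq_replicate_of_mem hall, Multiset.sum_replicate, hV, smul_eq_mul] at hsum
  exact Nat.eq_of_mul_eq_mul_right (by omega) hsum

lemma IsCycleColoring.cycleType {V κ : Type} [Fintype V] [DecidableEq V] [Fintype κ]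
    [DecidableEq κ] {σ : Perm V} {col : V → κ} {len : κ → ℕ} (h : IsCycleColoring σ col len)
    (hlen : ∀ c, 2 ≤ len c) : σ.cycleType = Finset.univ.val.map len := by
  obtain ⟨-, hi, ht, hc⟩ := h
  have hcard : ∀ c, (Finset.univ.filter fun p => col p = c).card = len c := fun c => by
    rw [← hc c, Finset.card_filter]
  have hrep : ∀ c, ∃ p, col p = c := fun c => by
    obtain ⟨p, hp⟩ := Finset.card_pos.1 (by rw [hcard c]; have := hlen c; omega)
    exact ⟨p, (Finset.mem_filter.1 hp).2⟩
  choose r hr using hrep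
  have hin : ∀ (n : ℕ) p, col ((σ ^ n) p) = col p := by
    intro n
    induction n with
    | zero => simp
    | succ n ih => intro p; rw [pow_succ', Perm.mul_apply, hi, ih]
  have hsame : ∀ p q, σ.SameCycle p q ↔ col p = col q := by
    refine fun p q => ⟨fun hpq => ?_, fun hpq => ?_⟩
    · obtain ⟨n, -, rfl⟩ := hpq.exists_pow_eq'
      exact (hin n p).symm
    · obtain ⟨n, hn⟩ := ht p q hpq
      exact ⟨n, by simpa [Perm.iterate_eq_pow] using hn⟩
  have hmoved : ∀ p, p ∈ σ.support := by
    intro p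
    rw [Perm.mem_support]
    intro hp
    obtain ⟨q, hq, hqp⟩ := Finset.exists_mem_ne (s := Finset.univ.filter fun q => col q = col p)
      (by rw [hcard]; have := hlen (col p); omega) p
    obtain ⟨n, hn⟩ := ht p q (Finset.mem_filter.1 hq).2.symm
    rw [Function.iterate_fixed hp] at hn
    exact hqp hn.symm
  have hsupp : ∀ c, (σ.cycleOf (r c)).support = Finset.univ.filter fun p => col p = c := by
    intro c
    ext p
    rw [Perm.mem_support_cycleOf_iff, hsame, hr]
    simp [hmoved, eq_comm]
  have hinj : Injective fun c => σ.cycleOf (r c) := by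
    intro c d hcd
    have := hsupp c
    rw [show σ.cycleOf (r c) = σ.cycleOf (r d) from hcd, hsupp d] at this
    have h' : r c ∈ Finset.univ.filter fun p => col p = c := by simp [hr]
    rw [← this] at h'
    simpa [hr] using h'
  have hfin : σ.cycleFactorsFinset = Finset.univ.map ⟨_, hinj⟩ := by
    ext c
    simp only [Finset.mem_map, Finset.mem_univ, true_and, Embedding.coeFn_mk]
    constructor
    · intro hcm
      obtain ⟨x, hx⟩ := Finset.card_pos.1 (by
        have := (Perm.mem_cycleFactorsFinset_iff.1 hcm).1.two_le_card_support; omega :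
        0 < c.support.card)
      refine ⟨col x, ?_⟩
      rw [Perm.cycle_is_cycleOf hx hcm]
      exact Perm.SameCycle.cycleOf_eq ((hsame _ _).2 (hr _))
    · rintro ⟨d, rfl⟩
      exact Perm.cycleOf_mem_cycleFactorsFinset_iff.2 (hmoved _)
  rw [Perm.cycleType_def, hfin, Finset.map_val, Multiset.map_map]
  refine Multiset.map_congr rfl fun c _ => ?_
  simp [hsupp, hcard]

open Classical in
/-- A regular bipartite relation is a union of perfect matchings. -/
lemma exists_matchings {X Y : Type*} [Fintype X] [Fintype Y] (hXY : Fintype.card X = Fintype.card Y)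
    (k : ℕ) (r : X → Y → Prop) (hX : ∀ x, (Finset.univ.filter fun y => r x y).card = k)
    (hY : ∀ y, (Finset.univ.filter fun x => r x y).card = k) :
    ∃ φ : Fin k → X ≃ Y, ∀ x y, r x y → ∃ i, φ i x = y := by
  induction k generalizing r with
  | zero =>
    refine ⟨Fin.elim0, fun x y h => ?_⟩
    have := hX x
    rw [Finset.card_eq_zero, Finset.filter_eq_empty_iff] at this
    exact absurd h (this (Finset.mem_univ y))
  | succ k ih =>
    obtain ⟨g, hg, hr⟩ := (Fintype.all_card_le_filter_rel_iff_exists_injective r).1 fun A => by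
      have := Finset.card_mul_le_card_mul r (s := A)
        (t := Finset.univ.filter fun y => ∃ a ∈ A, r a y) (m := k + 1) (n := k + 1) ?_ ?_
      · exact Nat.le_of_mul_le_mul_right this (Nat.succ_pos k)
      · intro a ha
        rw [← hX a]
        refine Finset.card_le_card fun y hy => ?_
        simp only [Finset.mem_filter, Finset.mem_univ, true_and] at hy
        simp only [Finset.mem_bipartiteAbove, Finset.mem_filter, Finset.mem_univ, true_and]
        exact ⟨⟨a, ha, hy⟩, hy⟩
      · intro b _
        rw [← hY b]
        refine Finset.card_le_card fun x hx => ?_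
        simp only [Finset.mem_bipartiteBelow] at hx
        simpa using hx.2
    let e : X ≃ Y := Equiv.ofBijective g ((Fintype.bijective_iff_injective_and_card g).2 ⟨hg, hXY⟩)
    have hre : ∀ x, r x (e x) := hr
    obtain ⟨φ, hφ⟩ := ih (fun x y => r x y ∧ e x ≠ y) (fun x => by
      have : (Finset.univ.filter fun y => r x y ∧ e x ≠ y) =
          (Finset.univ.filter fun y => r x y).erase (e x) := by
        ext y
        simp [and_comm, eq_comm]
      have h := Finset.card_erase_of_mem (s := Finset.univ.filter fun y => r x y) (a := e x)
        (by simp [hre])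
      rw [← this, hX, Nat.add_sub_cancel] at h
      convert h) (fun y => by
      have : (Finset.univ.filter fun x => r x y ∧ e x ≠ y) =
          (Finset.univ.filter fun x => r x y).erase (e.symm y) := by
        ext x
        simp [and_comm, Equiv.eq_symm_apply]
      have h := Finset.card_erase_of_mem (s := Finset.univ.filter fun x => r x y)
        (a := e.symm y) (by simpa using hre (e.symm y))
      rw [← this, hY, Nat.add_sub_cancel] at h
      convert h)
    refine ⟨Fin.cons e φ, fun x y h => ?_⟩
    by_cases hxy : e x = y
    · exact ⟨0, hxy⟩
    · obtain ⟨i, hi⟩ := hφ x y ⟨h, hxy⟩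
      exact ⟨i.succ, hi⟩

lemma exists_latin_completion {X Y : Type*} [Fintype X] [Fintype Y] {n : ℕ}
    (hX : Fintype.card X = n) (hY : Fintype.card Y = n) (f g : X ≃ Y) (hfg : ∀ x, f x ≠ g x) :
    ∃ φ : Fin (n - 2) → X ≃ Y, ∀ x y, f x ≠ y → g x ≠ y → ∃ i, φ i x = y := by
  classical
  obtain ⟨φ, hφ⟩ := exists_matchings (hX.trans hY.symm) (n - 2) (fun x y => f x ≠ y ∧ g x ≠ y)
    (fun x => by
      have : (Finset.univ.filter fun y => f x ≠ y ∧ g x ≠ y) = {f x, g x}ᶜ := by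
        ext y; simp [eq_comm]
      have h := Finset.card_compl {f x, g x}
      rw [← this, Finset.card_pair (hfg x), hY] at h
      convert h)
    (fun y => by
      have : (Finset.univ.filter fun x => f x ≠ y ∧ g x ≠ y) = {f.symm y, g.symm y}ᶜ := by
        ext x; simp [Equiv.eq_symm_apply]
      have h := Finset.card_compl {f.symm y, g.symm y}
      rw [← this, Finset.card_pair, hX] at h
      · convert h
      · intro h
        apply hfg (f.symm y)
        conv_rhs => rw [h]
        simp)
  exact ⟨φ, fun x y h₁ h₂ => hφ x y ⟨h₁, h₂⟩⟩

/-- The permutation `x ↦ φ x`, `y ↦ p (φ⁻¹ y)`. -/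
def crossPerm {X Y : Type*} (φ : X ≃ Y) (p : Perm X) : Perm (X ⊕ Y) :=
  (Equiv.sumCongr φ (φ.symm.trans p)).trans (Equiv.sumComm Y X)

lemma isCycleColoring_crossPerm {X Y κ : Type} [Fintype X] [Fintype Y] [DecidableEq κ] {p : Perm X}
    {col : X → κ} {len : κ → ℕ} (h : IsCycleColoring p col len) (φ : X ≃ Y) :
    IsCycleColoring (crossPerm φ p) (Sum.elim col (col ∘ φ.symm)) fun c => 2 * len c := by
  obtain ⟨-, hi, ht, hc⟩ := h
  have hl : ∀ x, crossPerm φ p (.inl x) = .inr (φ x) := fun x => rfl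
  have hr : ∀ y, crossPerm φ p (.inr y) = .inl (p (φ.symm y)) := fun y => rfl
  have hll : ∀ n x, (crossPerm φ p)^[2 * n] (.inl x) = .inl (p^[n] x) := by
    intro n
    induction n with
    | zero => simp
    | succ n ih =>
      intro x
      rw [mul_add, mul_one, iterate_add_apply, iterate_succ_apply (n := n)]
      simp [hl, hr, ih]
  refine ⟨(crossPerm φ p).surjective, ?_, ?_, ?_⟩
  · rintro (x | y)
    · simp [hl]
    · simp [hr, hi]
  · intro v w hvw
    have hto : ∀ v, ∃ x, col x = Sum.elim col (col ∘ φ.symm) v ∧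
        ∃ n, (crossPerm φ p)^[n] v = .inl x := by
      rintro (x | y)
      · exact ⟨x, rfl, 0, rfl⟩
      · exact ⟨p (φ.symm y), hi _, 1, hr y⟩
    have hfrom : ∀ w, ∃ x, col x = Sum.elim col (col ∘ φ.symm) w ∧
        ∃ n, (crossPerm φ p)^[n] (.inl x) = w := by
      rintro (x | y)
      · exact ⟨x, rfl, 0, rfl⟩
      · exact ⟨φ.symm y, rfl, 1, by simp [hl]⟩
    obtain ⟨x, hx, h₁⟩ := hto v
    obtain ⟨x', hx', h₂⟩ := hfrom w
    obtain ⟨n, hn⟩ := ht x x' (by rw [hx, hx', hvw])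
    exact reach_trans h₁ (reach_trans ⟨2 * n, by rw [hll, hn]⟩ h₂)
  · intro c
    change _ = 2 * len c
    rw [Fintype.sum_sum_type, two_mul, ← hc c]
    congr 1
    exact Fintype.sum_equiv φ.symm _ _ fun y => rfl

/-- The complete symmetric digraph on `V`, minus the arcs of the involution `I`, decomposes into
factors consisting of cycles of length `t`. -/
def IsAlmostFactorable (V : Type) [Fintype V] (I : V → V) (t : ℕ) : Prop :=
  ∃ (ι : Type) (_ : Fintype ι) (τ : ι → Perm V), Fintype.card ι + 2 = Fintype.card V ∧
    (∀ x y, x ≠ y → y ≠ I x → ∃ i, τ i x = y) ∧ ∀ i x k, (τ i ^ k) x = x ↔ t ∣ k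

lemma cycleType_sumCongr {X Y : Type*} [Fintype X] [DecidableEq X] [Fintype Y] [DecidableEq Y]
    (σ : Perm X) (τ : Perm Y) :
    (Perm.sumCongr σ τ).cycleType = σ.cycleType + τ.cycleType := by
  have hl : Perm.sumCongr σ (1 : Perm Y) = σ.extendDomain (ofInjective Sum.inl Sum.inl_injective :
      X ≃ Set.range (Sum.inl : X → X ⊕ Y)) := by
    ext (x | y)
    · exact (Perm.extendDomain_apply_image σ (ofInjective Sum.inl Sum.inl_injective) x).symm
    · exact (Perm.extendDomain_apply_not_subtype _ _ (by simp)).symm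
  have hr : Perm.sumCongr (1 : Perm X) τ = τ.extendDomain (ofInjective Sum.inr Sum.inr_injective :
      Y ≃ Set.range (Sum.inr : Y → X ⊕ Y)) := by
    ext (x | y)
    · exact (Perm.extendDomain_apply_not_subtype _ _ (by simp)).symm
    · exact (Perm.extendDomain_apply_image τ (ofInjective Sum.inr Sum.inr_injective) y).symm
  have hd : Perm.Disjoint (Perm.sumCongr σ (1 : Perm Y)) (Perm.sumCongr (1 : Perm X) τ) := by
    rintro (x | y) <;> simp
  have hm : Perm.sumCongr σ τ = Perm.sumCongr σ (1 : Perm Y) * Perm.sumCongr (1 : Perm X) τ := by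
    ext (x | y) <;> simp
  rw [hm, hd.cycleType_mul, hl, hr, Perm.cycleType_extendDomain, Perm.cycleType_extendDomain]

lemma IsCycleColoring.card_eq {V κ : Type} [Fintype V] [Fintype κ] [DecidableEq κ] {g : V → V}
    {col : V → κ} {len : κ → ℕ} (h : IsCycleColoring g col len) :
    Fintype.card V = ∑ c, len c := by
  simp_rw [← h.2.2.2]
  rw [Finset.sum_comm]
  simp

lemma Core.hasOPSolution {κ : Type} [Fintype κ] [DecidableEq κ] {h : κ → ℕ} {X Y V : Type}
    [Fintype X] [Fintype Y] [Fintype V] (D : Core h X Y V) {n a b s t : ℕ} (hs : 2 ≤ s)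
    (ht : 2 ≤ t) (hX : Fintype.card X = n) (hY : Fintype.card Y = n) (ha : n = a * s)
    (hb : n = b * t)
    (hμ : Finset.univ.val.map (fun c => 2 * h c) =
      Multiset.replicate a s + Multiset.replicate b t)
    (hI₀ : IsAlmostFactorable X D.I₀ s) (hI₁ : IsAlmostFactorable Y D.I₁ t) :
    HasOPSolution (List.replicate a s ++ List.replicate b t) := by
  classical
  obtain ⟨ι, _, lam, hι, hlam, hlam'⟩ := hI₀
  obtain ⟨ι', _, rho, hι', hrho, hrho'⟩ := hI₁
  let f (e : Bool) : X ≃ Y := Equiv.ofBijective _ (D.f_bij e)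
  have hf : ∀ e x, f e x = D.f e x := fun _ _ => rfl
  obtain ⟨φ, hφ⟩ := exists_latin_completion hX hY (f false) (f true) D.f_ne
  let p : Perm X := Equiv.ofBijective D.p (Finite.surjective_iff_bijective.1 D.cyc_p.1)
  have hp : ∀ x, p x = D.p x := fun _ => rfl
  let σ (k : Fin 3) : Perm V :=
    Equiv.ofBijective (D.σ k) (Finite.surjective_iff_bijective.1 (D.cyc k).1)
  have hσ : ∀ k v, σ k v = D.σ k v := fun _ _ => rfl
  let E : X ⊕ Y ≃ V := Equiv.ofBijective _ D.bij
  have hEl : ∀ x, E (.inl x) = D.L x := fun _ => rfl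
  have hEr : ∀ y, E (.inr y) = D.R y := fun _ => rfl
  let e : ι ≃ ι' := Fintype.equivOfCardEq (by omega)
  have hlen : ∀ c, 2 ≤ 2 * h c := by
    intro c
    have : 2 * h c ∈ Finset.univ.val.map (fun c => 2 * h c) :=
      Multiset.mem_map_of_mem _ (Finset.mem_univ c)
    rw [hμ, Multiset.mem_add, Multiset.mem_replicate, Multiset.mem_replicate] at this
    omega
  have hV : Fintype.card V = n + n := by
    rw [← Fintype.card_congr E, Fintype.card_sum, hX, hY]
  have hsum : (List.replicate a s ++ List.replicate b t).sum = n + n := by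
    rw [List.sum_append, List.sum_replicate, List.sum_replicate, smul_eq_mul, smul_eq_mul, ← ha,
      ← hb]
  have hn : 2 ≤ n := by omega
  refine hasOPSolution_of_cover (V := V) (ι := ι ⊕ Fin (n - 2) ⊕ Fin 3) (hV.trans hsum.symm) ?_
    (Sum.elim (fun i => E.permCongr (Perm.sumCongr (lam i) (rho (e i))))
      (Sum.elim (fun i => E.permCongr (crossPerm (φ i) p)) σ)) ?_ ?_
  · rw [Fintype.card_sum, Fintype.card_sum, Fintype.card_fin, Fintype.card_fin, hsum]
    omega
  · rw [← Multiset.coe_add, Multiset.coe_replicate, Multiset.coe_replicate]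
    rintro (i | i | k)
    · rw [Sum.elim_inl, cycleType_permCongr, cycleType_sumCongr,
        cycleType_eq_replicate hs (hX.trans ha) (hlam' i),
        cycleType_eq_replicate ht (hY.trans hb) (hrho' (e i))]
    · rw [Sum.elim_inr, Sum.elim_inl, cycleType_permCongr,
        (isCycleColoring_crossPerm (p := p) D.cyc_p (φ i)).cycleType hlen, hμ]
    · rw [Sum.elim_inr, Sum.elim_inr, IsCycleColoring.cycleType (σ := σ k) (D.cyc k) hlen, hμ]
  · intro v w
    obtain ⟨v, rfl⟩ := E.surjective v
    obtain ⟨w, rfl⟩ := E.surjective w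
    rcases v with x | y <;> rcases w with x' | y' <;> intro hvw
    · by_cases hx : x' = D.I₀ x
      · obtain ⟨k, hk⟩ := D.arc_I₀ x
        exact ⟨.inr (.inr k), by simp [hEl, hσ, hk, hx]⟩
      · obtain ⟨i, hi⟩ := hlam x x' (fun h => hvw (by rw [h])) hx
        exact ⟨.inl i, by simp [hi]⟩
    · by_cases h : ∃ b, D.f b x = y'
      · obtain ⟨b, rfl⟩ := h
        obtain ⟨k, hk⟩ := D.arc_f b x
        exact ⟨.inr (.inr k), by simp [hEl, hEr, hσ, hk]⟩
      · push Not at h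
        obtain ⟨i, hi⟩ := hφ x y' (h false) (h true)
        exact ⟨.inr (.inl i), by simp [crossPerm, hi]⟩
    · obtain ⟨z, rfl⟩ := p.surjective x'
      by_cases h : ∃ b, D.f b z = y
      · obtain ⟨b, rfl⟩ := h
        obtain ⟨k, hk⟩ := D.arc_p b z
        exact ⟨.inr (.inr k), by simp [hEl, hEr, hσ, hk, hp]⟩
      · push Not at h
        obtain ⟨i, rfl⟩ := hφ z y (h false) (h true)
        exact ⟨.inr (.inl i), by simp [crossPerm]⟩
    · by_cases hy : y' = D.I₁ y
      · obtain ⟨k, hk⟩ := D.arc_I₁ y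
        exact ⟨.inr (.inr k), by simp [hEr, hσ, hk, hy]⟩
      · obtain ⟨i, hi⟩ := hrho y y' (fun h => hvw (by rw [h])) hy
        exact ⟨.inl (e.symm i), by simp [hi]⟩

lemma permCongr_pow {V W : Type*} (e : V ≃ W) (σ : Perm V) (k : ℕ) :
    e.permCongr σ ^ k = e.permCongr (σ ^ k) :=
  (map_pow e.permCongrHom σ k).symm

lemma exists_conj_of_involutive {V V' : Type*} [Fintype V] [Fintype V'] {k : ℕ}
    (hV : Fintype.card V = k * 2) (hV' : Fintype.card V' = k * 2) {I : V → V} {I' : V' → V'}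
    (hI : Involutive I) (hne : ∀ x, I x ≠ x) (hI' : Involutive I') (hne' : ∀ x, I' x ≠ x) :
    ∃ e : V ≃ V', ∀ x, e (I x) = I' (e x) := by
  classical
  have key : ∀ (J : V → V) (hJ : Involutive J), (∀ x, J x ≠ x) →
      (hJ.toPerm : Perm V).cycleType = Multiset.replicate k 2 := by
    intro J hJ hJne
    refine cycleType_eq_replicate le_rfl hV fun x n => ?_
    rw [← Perm.iterate_eq_pow]
    change J^[n] x = x ↔ _
    rcases Nat.even_or_odd n with hn | hn
    · simp [hJ.iterate_even hn, hn.two_dvd]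
    · simp [hJ.iterate_odd hn, hJne, ← even_iff_two_dvd, hn]
  let f : V ≃ V' := Fintype.equivOfCardEq (hV.trans hV'.symm)
  let J : V → V := fun x => f.symm (I' (f x))
  have hJ : Involutive J := fun x => by simp [J, hI' _]
  obtain ⟨g, hg⟩ := isConj_iff.1 (Perm.isConj_of_cycleType_eq ((key I hI hne).trans (key J hJ
    fun x h => hne' (f x) (by simpa [J, Equiv.symm_apply_eq] using h)).symm))
  refine ⟨g.trans f, fun x => ?_⟩
  have : g (I x) = J (g x) := by
    rw [mul_inv_eq_iff_eq_mul] at hg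
    exact congrArg (fun σ : Perm V => σ x) hg
  simp [this, J]

lemma IsAlmostFactorable.congr {V V' : Type} [Fintype V] [Fintype V'] {I : V → V} {I' : V' → V'}
    {t : ℕ} (h : IsAlmostFactorable V I t) (e : V ≃ V') (he : ∀ x, e (I x) = I' (e x)) :
    IsAlmostFactorable V' I' t := by
  obtain ⟨ι, _, τ, hι, hc, hτ⟩ := h
  refine ⟨ι, _, fun i => e.permCongr (τ i), by rw [hι, Fintype.card_congr e], ?_, fun i x k => ?_⟩
  · intro x y hxy hI
    obtain ⟨x, rfl⟩ := e.surjective x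
    obtain ⟨y, rfl⟩ := e.surjective y
    obtain ⟨i, hi⟩ := hc x y (fun h => hxy (by rw [h])) (fun h => hI (by rw [h, he]))
    exact ⟨i, by simp [hi]⟩
  · rw [permCongr_pow, permCongr_apply, ← Equiv.eq_symm_apply, hτ]

/-- The perfect matchings of the round-robin 1-factorization of the complete graph on
`2 * m + 2` points. -/
def roundRobin (m : ℕ) (c : ZMod (2 * m + 1)) :
    Option (ZMod (2 * m + 1)) → Option (ZMod (2 * m + 1))
  | none => some (c * (m + 1))
  | some x => if 2 * x = c then none else some (c - x)

section roundRobin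

variable {m : ℕ}

lemma two_mul_add_one_eq_zero : (2 * m + 1 : ZMod (2 * m + 1)) = 0 := by
  have := ZMod.natCast_self (2 * m + 1)
  push_cast at this
  exact this

lemma roundRobin_involutive (c : ZMod (2 * m + 1)) : Involutive (roundRobin m c) := by
  have h := two_mul_add_one_eq_zero (m := m)
  rintro (_ | x)
  · have : 2 * (c * (m + 1)) = c := by linear_combination c * h
    simp [roundRobin, this]
  · by_cases hx : 2 * x = c
    · have : c * (m + 1) = x := by linear_combination (-(m + 1 : ZMod (2 * m + 1))) * hx + x * h
      simp [roundRobin, hx, this]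
    · have : ¬ 2 * (c - x) = c := fun h => hx (by linear_combination -h)
      simp [roundRobin, hx, this]

lemma roundRobin_ne (c : ZMod (2 * m + 1)) (v) : roundRobin m c v ≠ v := by
  rcases v with _ | x
  · simp [roundRobin]
  · by_cases hx : 2 * x = c
    · simp [roundRobin, hx]
    · simp only [roundRobin, hx, if_false, ne_eq, Option.some.injEq]
      exact fun h => hx (by linear_combination -h)

lemma exists_roundRobin_eq {v w : Option (ZMod (2 * m + 1))} (h : v ≠ w) :
    ∃ c, roundRobin m c v = w := by
  rcases v with _ | x <;> rcases w with _ | y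
  · exact absurd rfl h
  · refine ⟨2 * y, ?_⟩
    rw [← roundRobin_involutive (2 * y) (some y)]
    simp [roundRobin]
  · exact ⟨2 * x, by simp [roundRobin]⟩
  · refine ⟨x + y, ?_⟩
    have : ¬ 2 * x = x + y := fun hx => h (by rw [show x = y by linear_combination hx])
    simp [roundRobin, this]

lemma roundRobin_translate (c d : ZMod (2 * m + 1)) (v) :
    roundRobin m (c + 2 * d) (v.map (d + ·)) = (roundRobin m c v).map (d + ·) := by
  have h := two_mul_add_one_eq_zero (m := m)
  rcases v with _ | x
  · simp only [roundRobin, Option.map_none, Option.map_some, Option.some.injEq]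
    linear_combination d * h
  · by_cases hx : 2 * x = c
    · have : 2 * (d + x) = c + 2 * d := by linear_combination hx
      simp [roundRobin, hx, this]
    · have : ¬ 2 * (d + x) = c + 2 * d := fun h => hx (by linear_combination h)
      simp only [roundRobin, hx, this, Option.map_some, if_false, Option.some.injEq]
      ring

/-- The zigzag Hamiltonian cycle alternating between two perfect matchings. -/
def zigzag (m j : ℕ) : Option (ZMod (2 * m + 1)) :=
  if j = 0 then none else if j % 2 = 0 then some (j / 2 : ℕ) else some (-(j / 2 : ℕ))

lemma zigzag_even {k : ℕ} (hk : k ≠ 0) : zigzag m (2 * k) = some (k : ZMod (2 * m + 1)) := by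
  simp [zigzag, hk]

lemma zigzag_odd (k : ℕ) : zigzag m (2 * k + 1) = some (-k : ZMod (2 * m + 1)) := by
  have : (2 * k + 1) / 2 = k := by omega
  simp [zigzag, this, Nat.add_mod]

lemma roundRobin_zigzag_even {k : ℕ} (hk : k ≤ m) :
    roundRobin m 0 (zigzag m (2 * k)) = zigzag m (2 * k + 1) := by
  rw [zigzag_odd]
  rcases eq_or_ne k 0 with rfl | hk0
  · simp [zigzag, roundRobin]
  · rw [zigzag_even hk0]
    have : ¬ (2 * k : ZMod (2 * m + 1)) = 0 := by
      rw [show (2 * k : ZMod (2 * m + 1)) = (2 * k : ℕ) by push_cast; rfl,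
        ZMod.natCast_eq_zero_iff]
      exact fun h => by have := Nat.le_of_dvd (by omega) h; omega
    simp [roundRobin, this]

lemma roundRobin_zigzag_odd {k : ℕ} (hk : k ≤ m) :
    roundRobin m 1 (zigzag m (2 * k + 1)) = zigzag m ((2 * k + 2) % (2 * m + 2)) := by
  rw [zigzag_odd]
  rcases hk.eq_or_lt with rfl | hk
  · have : (2 * -k : ZMod (2 * k + 1)) = 1 := by
      linear_combination -two_mul_add_one_eq_zero (m := k)
    simp [roundRobin, this, zigzag]
  · have : ¬ (2 * -k : ZMod (2 * m + 1)) = 1 := by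
      intro h
      have h' : ((2 * k + 1 : ℕ) : ZMod (2 * m + 1)) = 0 := by
        push_cast
        linear_combination -h
      rw [ZMod.natCast_eq_zero_iff] at h'
      have := Nat.le_of_dvd (by omega) h'
      omega
    rw [Nat.mod_eq_of_lt (by omega), show 2 * k + 2 = 2 * (k + 1) by ring,
      zigzag_even (Nat.succ_ne_zero k)]
    simp only [roundRobin, this, if_false]
    simp [add_comm]

lemma zigzag_surjective (v : Option (ZMod (2 * m + 1))) : ∃ j < 2 * m + 2, zigzag m j = v := by
  rcases v with _ | x
  · exact ⟨0, by omega, rfl⟩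
  · obtain ⟨k, hk, rfl⟩ : ∃ k < 2 * m + 1, (k : ZMod (2 * m + 1)) = x :=
      ⟨x.val, x.val_lt, ZMod.natCast_zmod_val x⟩
    by_cases hkm : k ≤ m
    · rcases eq_or_ne k 0 with rfl | hk0
      · exact ⟨1, by omega, by simpa using zigzag_odd (m := m) 0⟩
      · exact ⟨2 * k, by omega, zigzag_even hk0⟩
    · refine ⟨2 * (2 * m + 1 - k) + 1, by omega, ?_⟩
      rw [zigzag_odd, Nat.cast_sub hk.le]
      simp

/-- Walecki's decomposition into Hamiltonian cycles. -/
lemma isAlmostFactorable_roundRobin (m : ℕ) :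
    IsAlmostFactorable (Option (ZMod (2 * m + 1))) (roundRobin m (-1)) (2 * m + 2) := by
  let w : ZMod (2 * m + 2) → Option (ZMod (2 * m + 1)) := fun j => zigzag m j.val
  have hw : Bijective w := by
    rw [Fintype.bijective_iff_surjective_and_card]
    refine ⟨fun v => ?_, by simp [ZMod.card]⟩
    obtain ⟨j, hj, rfl⟩ := zigzag_surjective v
    exact ⟨j, by simp only [w]; rw [ZMod.val_natCast_of_lt hj]⟩
  let e := Equiv.ofBijective w hw
  have he : ∀ j, e j = zigzag m j.val := fun j => rfl
  have hen : ∀ n : ℕ, e n = zigzag m (n % (2 * m + 2)) := fun n => by rw [he, ZMod.val_natCast]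
  let T (d : ZMod (2 * m + 1)) : Perm (Option (ZMod (2 * m + 1))) := (Equiv.addLeft d).optionCongr
  have hT : ∀ d v, T d v = v.map (d + ·) := fun d v => rfl
  have hstep : ∀ (ε : Bool) j, ∃ s : Bool, roundRobin m (bif ε then 1 else 0) (e j) =
      e (j + bif s then 1 else -1) := by
    have h0 : ∀ k ≤ m, roundRobin m 0 (e (2 * k : ℕ)) = e ((2 * k : ℕ) + 1) := by
      intro k hk
      rw [← Nat.cast_succ, hen, hen, Nat.mod_eq_of_lt (by omega), Nat.mod_eq_of_lt (by omega),
        roundRobin_zigzag_even hk]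
    have h1 : ∀ k ≤ m, roundRobin m 1 (e (2 * k + 1 : ℕ)) = e ((2 * k + 1 : ℕ) + 1) := by
      intro k hk
      rw [← Nat.cast_succ, hen, hen, Nat.mod_eq_of_lt (by omega), roundRobin_zigzag_odd hk]
    intro ε j
    obtain ⟨n, hn, rfl⟩ : ∃ n < 2 * m + 2, (n : ZMod (2 * m + 2)) = j :=
      ⟨j.val, j.val_lt, ZMod.natCast_zmod_val j⟩
    obtain ⟨k, rfl | rfl⟩ := Nat.even_or_odd' n <;> cases ε
    · exact ⟨true, h0 k (by omega)⟩
    · refine ⟨false, ?_⟩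
      rcases Nat.eq_zero_or_pos k with rfl | hk
      · rw [cond_true, (roundRobin_involutive 1).eq_iff, cond_false]
        have := h1 m le_rfl
        have h2 := ZMod.natCast_self (2 * m + 2)
        push_cast at this h2
        rw [show ((2 * m + 1 : ZMod (2 * m + 2)) + 1) = 0 by linear_combination h2] at this
        rw [show ((2 * 0 : ℕ) + -1 : ZMod (2 * m + 2)) = 2 * m + 1 by
          push_cast; linear_combination -h2, this]
        simp
      · obtain ⟨k, rfl⟩ := Nat.exists_eq_add_of_lt hk
        have := h1 k (by omega)
        rw [cond_true, (roundRobin_involutive 1).eq_iff, cond_false]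
        convert this.symm using 2
        · push_cast; ring
        · congr 1; push_cast; ring
    · refine ⟨false, ?_⟩
      rw [cond_false, (roundRobin_involutive 0).eq_iff, cond_false]
      convert (h0 k (by omega)).symm using 2
      · push_cast; ring
      · congr 1; push_cast; ring
    · exact ⟨true, h1 k (by omega)⟩
  refine ⟨Fin m × Bool, inferInstance, fun i => (T (i.1 : ℕ)).permCongr
    (e.permCongr (Equiv.addRight (bif i.2 then 1 else -1))), ?_, ?_, ?_⟩
  · simp [ZMod.card]
    ring
  · intro x y hxy hy
    obtain ⟨c, rfl⟩ := exists_roundRobin_eq hxy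
    obtain ⟨d, hd, ε, hc⟩ : ∃ d < m, ∃ ε : Bool,
        c = (bif ε then 1 else 0) + 2 * (d : ℕ) := by
      obtain ⟨n, hn, rfl⟩ : ∃ n < 2 * m + 1, (n : ZMod (2 * m + 1)) = c :=
        ⟨c.val, c.val_lt, ZMod.natCast_zmod_val c⟩
      obtain ⟨k, rfl | rfl⟩ := Nat.even_or_odd' n
      · refine ⟨k, ?_, false, by simp⟩
        refine lt_of_le_of_ne (by omega) ?_
        rintro rfl
        refine hy ?_
        congr 1
        push_cast
        linear_combination two_mul_add_one_eq_zero (m := k)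
      · exact ⟨k, by omega, true, by push_cast; simp [add_comm]⟩
    obtain ⟨v, rfl⟩ := (T d).surjective x
    obtain ⟨j, rfl⟩ := e.surjective v
    obtain ⟨s, hs⟩ := hstep ε j
    refine ⟨(⟨d, hd⟩, s), ?_⟩
    simp only [permCongr_apply, symm_apply_apply, coe_addRight]
    rw [← hs, hc, hT, hT, roundRobin_translate]
  · intro i x k
    have h₁ : ∀ (a : ZMod (2 * m + 2)) (k : ℕ), Equiv.addRight a ^ k = Equiv.addRight (k * a) := by
      intro a k
      ext
      simp
    have : ((T (i.1 : ℕ)).permCongr (e.permCongr (Equiv.addRight (bif i.2 then 1 else -1)))) ^ k =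
        (T (i.1 : ℕ)).permCongr (e.permCongr (Equiv.addRight (k * bif i.2 then 1 else -1))) := by
      rw [permCongr_pow, permCongr_pow, h₁]
    rw [this]
    simp only [permCongr_apply, ← Equiv.eq_symm_apply, coe_addRight, add_eq_left]
    rw [← ZMod.natCast_eq_zero_iff]
    cases i.2 <;> simp

end roundRobin

/-- The permutation of `P × Bool × ZMod τ` shifting the last coordinate by `i` or `1 - i` and
changing the sheet. -/
def sheetSwap (P : Type) (τ : ℕ) (i : ZMod τ) : Perm ((P × Bool) × ZMod τ) where
  toFun v := ((v.1.1, !v.1.2), v.2 + bif v.1.2 then i else 1 - i)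
  invFun v := ((v.1.1, !v.1.2), v.2 - bif v.1.2 then 1 - i else i)
  left_inv := by rintro ⟨⟨p, _ | _⟩, x⟩ <;> simp
  right_inv := by rintro ⟨⟨p, _ | _⟩, x⟩ <;> simp

lemma sheetSwap_pow_apply_eq_iff {P : Type} {τ : ℕ} (i : ZMod τ) (v : (P × Bool) × ZMod τ) (k : ℕ) :
    (sheetSwap P τ i ^ k) v = v ↔ 2 * τ ∣ k := by
  have h2 : ∀ (n : ℕ) (v : (P × Bool) × ZMod τ),
      (sheetSwap P τ i ^ (2 * n)) v = (v.1, v.2 + n) := by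
    intro n
    induction n with
    | zero => simp
    | succ n ih =>
      rintro ⟨⟨p, _ | _⟩, x⟩ <;>
      · rw [mul_add, mul_one, pow_add, Perm.mul_apply, pow_two, Perm.mul_apply, ih]
        simp [sheetSwap]
        ring
  obtain ⟨n, rfl | rfl⟩ := Nat.even_or_odd' k
  · rw [h2, Nat.mul_dvd_mul_iff_left two_pos, ← ZMod.natCast_eq_zero_iff]
    simp [Prod.ext_iff]
  · rw [pow_succ', Perm.mul_apply, h2]
    constructor
    · intro h
      simpa [sheetSwap] using congrArg (fun w => w.1.2) h
    · intro h
      have := (dvd_mul_right 2 τ).trans h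
      omega

/-- Blowing up a 1-factorization, one of whose 1-factors is replaced by copies of a
decomposition of `W`. -/
lemma IsAlmostFactorable.blowUp {W : Type} [Fintype W] {I : W → W} {τ : ℕ} [NeZero τ] (m : ℕ)
    (hW : IsAlmostFactorable W I (2 * τ)) (hcard : Fintype.card W = 2 * τ) (hI : Involutive I)
    (hne : ∀ x, I x ≠ x) :
    ∃ J : (Fin (m + 1) × W) → Fin (m + 1) × W, Involutive J ∧ (∀ x, J x ≠ x) ∧
      IsAlmostFactorable (Fin (m + 1) × W) J (2 * τ) := by
  obtain ⟨ι, _, ρ, hι, hc, hρ⟩ := hW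
  refine ⟨fun v => (v.1, I v.2), fun v => by simp [hI _], fun v h => hne v.2 (congrArg Prod.snd h),
    ?_⟩
  have hsplit : ∀ c, ∃ e : Option (ZMod (2 * m + 1)) ≃ Fin (m + 1) × Bool,
      ∀ x, e (roundRobin m c x) = ((e x).1, !(e x).2) := fun c =>
    exists_conj_of_involutive (I' := fun v => (v.1, !v.2)) (k := m + 1) (by simp [ZMod.card]; ring)
      (by simp) (roundRobin_involutive c) (roundRobin_ne c) (fun v => by simp) fun v => by
        simp [Prod.ext_iff]
  choose e he using hsplit
  let w : Bool × ZMod τ ≃ W := Fintype.equivOfCardEq (by simp [ZMod.card, hcard])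
  let E : Option (ZMod (2 * m + 1)) × ZMod τ ≃ Fin (m + 1) × W :=
    ((e (-1)).prodCongr (Equiv.refl _)).trans
      ((Equiv.prodAssoc _ _ _).trans ((Equiv.refl _).prodCongr w))
  have hE : ∀ v x, E (v, x) = ((e (-1) v).1, w ((e (-1) v).2, x)) := fun _ _ => rfl
  let ψ (c : ZMod (2 * m + 1)) : (Fin (m + 1) × Bool) × ZMod τ ≃ Fin (m + 1) × W :=
    ((e c).symm.prodCongr (Equiv.refl _)).trans E
  have hψ : ∀ c v x, ψ c (e c v, x) = E (v, x) := fun c v x => by simp [ψ]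
  refine ⟨{c : ZMod (2 * m + 1) // c ≠ -1} × ZMod τ ⊕ ι, inferInstance,
    Sum.elim (fun i => (ψ i.1).permCongr (sheetSwap _ τ i.2))
      fun i => (Equiv.refl _).prodCongr (ρ i), ?_, ?_, ?_⟩
  · have : Fintype.card {c : ZMod (2 * m + 1) // c ≠ -1} = 2 * m := by
      rw [Fintype.card_subtype_compl, Fintype.card_subtype_eq, ZMod.card, Nat.add_sub_cancel]
    rw [Fintype.card_sum, Fintype.card_prod, this, ZMod.card, Fintype.card_prod, add_assoc, hι,
      hcard, Fintype.card_fin]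
    ring
  · intro a b hab hJ
    obtain ⟨⟨v, x⟩, rfl⟩ := E.surjective a
    obtain ⟨⟨u, y⟩, rfl⟩ := E.surjective b
    by_cases hpiece : (e (-1) v).1 = (e (-1) u).1
    · simp only [hE, hpiece, ne_eq, Prod.mk.injEq, true_and] at hab hJ
      obtain ⟨i, hi⟩ := hc _ _ hab hJ
      exact ⟨.inr i, by simp [hE, hi, hpiece]⟩
    · have hvu : v ≠ u := fun h => hpiece (by rw [h])
      obtain ⟨c, rfl⟩ := exists_roundRobin_eq hvu
      have hc1 : c ≠ -1 := by
        rintro rfl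
        exact hpiece (by rw [he])
      refine ⟨.inl (⟨c, hc1⟩, bif (e c v).2 then y - x else 1 - (y - x)), ?_⟩
      rw [Sum.elim_inl, permCongr_apply, ← hψ c v, symm_apply_apply, ← hψ c (roundRobin m c v), he]
      congr 1
      cases h : (e c v).2 <;> simp [sheetSwap, h]
  · rintro (i | i) v k
    · rw [Sum.elim_inl, permCongr_pow, permCongr_apply, ← Equiv.eq_symm_apply,
        sheetSwap_pow_apply_eq_iff]
    · have : ∀ k, (((Equiv.refl _).prodCongr (ρ i) : Perm (Fin (m + 1) × W)) ^ k) v =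
          (v.1, (ρ i ^ k) v.2) := by
        intro k
        induction k with
        | zero => simp
        | succ k ih => rw [pow_succ', Perm.mul_apply, ih, pow_succ', Perm.mul_apply]; simp
      rw [Sum.elim_inr, this, Prod.ext_iff]
      simpa using hρ i v.2 k

lemma isAlmostFactorable_of_involutive {V : Type} [Fintype V] {I : V → V} {b t : ℕ}
    (hV : Fintype.card V = b * t) (hb : 0 < b) (ht : 2 ≤ t) (hte : Even t) (hI : Involutive I)
    (hne : ∀ x, I x ≠ x) : IsAlmostFactorable V I t := by
  obtain ⟨τ, rfl⟩ := hte.two_dvd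
  obtain ⟨m, rfl⟩ : ∃ m, b = m + 1 := ⟨b - 1, by omega⟩
  obtain ⟨n, rfl⟩ : ∃ n, τ = n + 1 := ⟨τ - 1, by omega⟩
  obtain ⟨J, hJ, hJne, h⟩ := IsAlmostFactorable.blowUp (τ := n + 1) m
    (isAlmostFactorable_roundRobin n)
    (by simp [ZMod.card]; ring) (roundRobin_involutive (-1)) (roundRobin_ne (-1))
  obtain ⟨e, he⟩ := exists_conj_of_involutive (k := (m + 1) * (n + 1)) (by simp [ZMod.card]; ring)
    (by rw [hV]; ring) hJ hJne hI hne
  exact h.congr e he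

lemma HasCore.hasOPSolution {a b s t : ℕ}
    (hcore : HasCore (Multiset.replicate a s + Multiset.replicate b t)) (ha : 0 < a) (hb : 0 < b)
    (hs : 2 ≤ s) (ht : 2 ≤ t) (hse : Even s) (hte : Even t) (h : a * s = b * t) :
    HasOPSolution (List.replicate a s ++ List.replicate b t) := by
  obtain ⟨κ, _, _, l, X, Y, V, _, _, _, ⟨D⟩, hμ⟩ := hcore
  have hX : Fintype.card X = a * s := by
    have := congrArg Multiset.sum hμ
    rw [Multiset.sum_add, Multiset.sum_replicate, Multiset.sum_replicate, smul_eq_mul,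
      smul_eq_mul] at this
    change ∑ c, 2 * l c = _ at this
    rw [← Finset.mul_sum, ← D.cyc_p.card_eq] at this
    omega
  have hY : Fintype.card Y = a * s := by
    rw [← hX, Fintype.card_of_bijective (D.f_bij false)]
  exact D.hasOPSolution hs ht hX hY rfl h hμ
    (isAlmostFactorable_of_involutive hX ha hs hse D.I₀_invol D.I₀_ne)
    (isAlmostFactorable_of_involutive (hY.trans h) hb ht hte D.I₁_invol D.I₁_ne)

lemma hasOPSolution_four_two_two {m : List ℕ} (hm : (m : Multiset ℕ) = {4, 2, 2}) :
    HasOPSolution m := by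
  let g : Fin 7 → Fin 8 → Fin 8 := fun i => tab ((![
      [1, 6, 7, 5, 0, 3, 4, 2],
      [2, 3, 0, 6, 7, 1, 5, 4],
      [3, 4, 5, 2, 1, 0, 7, 6],
      [4, 2, 1, 0, 6, 7, 3, 5],
      [5, 0, 4, 7, 2, 6, 1, 3],
      [6, 7, 3, 4, 5, 2, 0, 1],
      [7, 5, 6, 1, 3, 4, 2, 0]] : Fin 7 → List ℕ) i)
  let col : Fin 7 → Fin 8 → Fin 3 := fun i => tab ((![
      [0, 0, 1, 2, 0, 2, 0, 1],
      [1, 0, 1, 0, 2, 0, 0, 2],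
      [0, 1, 0, 0, 1, 0, 2, 2],
      [0, 1, 1, 0, 0, 2, 0, 2],
      [0, 0, 1, 2, 1, 0, 0, 2],
      [1, 2, 0, 0, 0, 0, 1, 2],
      [1, 0, 2, 0, 0, 0, 2, 1]] : Fin 7 → List ℕ) i)
  let root : Fin 7 → Fin 3 → Fin 8 := fun i => tab ((![
      [0, 2, 3],
      [1, 0, 4],
      [0, 1, 6],
      [0, 1, 5],
      [0, 2, 3],
      [2, 0, 1],
      [1, 0, 2]] : Fin 7 → List ℕ) i)
  have h : ∀ i, IsCycleColoring (g i) (col i) ![4, 2, 2] := fun i =>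
    isCycleColoring_of_root (root i) 4 (by decide +kernel +revert) (by decide +kernel +revert)
      (by decide +kernel +revert) (by decide +kernel +revert)
  have hsum : m.sum = 8 := by
    rw [← Multiset.sum_coe, hm]
    rfl
  refine hasOPSolution_of_cover (V := Fin 8) (by simp [hsum]) (by simp [hsum])
    (fun i : Fin 7 => Equiv.ofBijective (g i) (Finite.surjective_iff_bijective.1 (h i).1))
    (fun i => ?_) ?_
  · rw [IsCycleColoring.cycleType (h i) (by decide), hm]
    rfl
  · have : ∀ x y, x ≠ y → ∃ i, g i x = y := by decide +kernel
    exact this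

end Oberwolfach

/-- Corollary: for positive a, b and even s, t ≥ 2 with a·s = b·t,
OP*(s^⟨a⟩, t^⟨b⟩) has a solution. -/
theorem stmt8 (a b s t : ℕ) (ha : 0 < a) (hb : 0 < b)
    (hs : 2 ≤ s) (ht : 2 ≤ t) (hse : Even s) (hte : Even t)
    (h : a * s = b * t) :
    HasOPSolution (List.replicate a s ++ List.replicate b t) := by
  by_cases hex : a = 1 ∧ s = 4 ∧ t = 2
  · obtain ⟨rfl, rfl, rfl⟩ := hex
    obtain rfl : b = 2 := by omega
    exact hasOPSolution_four_two_two rfl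
  by_cases hex' : b = 1 ∧ t = 4 ∧ s = 2
  · obtain ⟨rfl, rfl, rfl⟩ := hex'
    obtain rfl : a = 2 := by omega
    exact hasOPSolution_four_two_two (by decide)
  exact (hasCore_main ha hb hs ht hse hte h hex hex').hasOPSolution ha hb hs ht hse hte h
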